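/- Let N_z be independent Multinomial(n_z, q_z) for z in {0,1} and suppose n_z/(n_0+n_1) converges to λ_z in (0,1). Given the counts, let (V_z*, V*_{z00}, V*_{z01}, V*_{z10}, V*_{z11}) be independent Dirichlet(1, N_z) for z in {0,1}, and let G* be the minimum of the continuously differentiable objective f(p_{00,00},...,p_{11,11}) over nonnegative p summing to 1 and satisfying the eight inequalities V*_{zay} ≤ (the corresponding sum of four p_{ij,kl} from the identities linking q to p). Assume there is an open set Q with q = (q_0,q_1) in Q, Q contained in the feasibility set F, on which the value function g (the constrained minimum of f as a function of q̄) is continuously differentiable. Then sqrt(n_0+n_1) * ( G* - g(N_0/n_0, N_1/n_1) ) converges in distribution in probability to N(0, σ^2), with σ^2 = sum over z in {0,1} of λ_z^{-1} [ sum over a,y of (∂g(q)/∂q_{zay})^2 q_{zay} - ( sum over a,y of (∂g(q)/∂q_{zay}) q_{zay} )^2 ]. -/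

import Mathlib

open MeasureTheory ProbabilityTheory Filter Matrix
open scoped ENNReal NNReal Topology

/-- The categorical distribution on a finite type. -/
noncomputable def categorical {ι : Type*} [Fintype ι] [MeasurableSpace ι] (q : ι → ℝ) :
    Measure ι := ∑ i : ι, ENNReal.ofReal (q i) • Measure.dirac i

/-- The multinomial distribution of category counts for `n` independent trials. -/
noncomputable def multinomial (ι : Type*) [Fintype ι] [DecidableEq ι] [MeasurableSpace ι]
    (n : ℕ) (q : ι → ℝ) : Measure (ι → ℕ) :=
  Measure.map (fun (x : Fin n → ι) (j : ι) => (Finset.univ.filter (fun i => x i = j)).card)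
    (Measure.pi fun _ : Fin n => categorical q)

/-- The Gamma distribution with shape `a` and rate `1`, with the convention
`Gamma(0, 1) = δ₀`. -/
noncomputable def gammaShape (a : ℝ) : Measure ℝ :=
  if a = 0 then Measure.dirac 0 else gammaMeasure a 1

/-- The Dirichlet distribution with shape vector `a`: the law of
`(X i / ∑ j, X j) i` for independent `X i ~ Gamma(a i, 1)`. -/
noncomputable def dirichlet {ι : Type*} [Fintype ι] (a : ι → ℝ) : Measure (ι → ℝ) :=
  Measure.map (fun x i => x i / ∑ j : ι, x j) (Measure.pi fun i : ι => gammaShape (a i))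

/-- The eight identities linking the counterfactual probabilities `p i j k l`
(`i = A₀, j = A₁, k = Y₀, l = Y₁`) to the observable probabilities
`q0 (a, y) = q_{0ay}` and `q1 (a, y) = q_{1ay}`. -/
def linkEqs (p : Fin 2 → Fin 2 → Fin 2 → Fin 2 → ℝ)
    (q0 q1 : Fin 2 × Fin 2 → ℝ) : Prop :=
  q0 (0, 0) = p 0 0 0 1 + p 0 0 0 0 + p 0 1 0 1 + p 0 1 0 0 ∧
  q0 (0, 1) = p 0 0 1 0 + p 0 0 1 1 + p 0 1 1 1 + p 0 1 1 0 ∧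
  q0 (1, 0) = p 1 1 1 0 + p 1 1 0 0 + p 1 0 1 0 + p 1 0 0 0 ∧
  q0 (1, 1) = p 1 1 0 1 + p 1 1 1 1 + p 1 0 1 1 + p 1 0 0 1 ∧
  q1 (0, 0) = p 0 0 0 1 + p 0 0 0 0 + p 1 0 0 1 + p 1 0 0 0 ∧
  q1 (0, 1) = p 0 0 1 0 + p 0 0 1 1 + p 1 0 1 1 + p 1 0 1 0 ∧
  q1 (1, 0) = p 1 1 1 0 + p 1 1 0 0 + p 0 1 1 0 + p 0 1 0 0 ∧
  q1 (1, 1) = p 1 1 0 1 + p 1 1 1 1 + p 0 1 1 1 + p 0 1 0 1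

/-- The feasibility set `F`: pairs of points of the 3-dimensional probability simplex for
which there exist nonnegative counterfactual probabilities `p i j k l` summing to `1`
satisfying the eight identities. -/
def Feas : Set (((Fin 2 × Fin 2) → ℝ) × ((Fin 2 × Fin 2) → ℝ)) :=
  {qq | qq.1 ∈ stdSimplex ℝ (Fin 2 × Fin 2) ∧ qq.2 ∈ stdSimplex ℝ (Fin 2 × Fin 2) ∧
    ∃ p : Fin 2 → Fin 2 → Fin 2 → Fin 2 → ℝ,
      (∀ i j k l, 0 ≤ p i j k l) ∧
      (∑ i : Fin 2, ∑ j : Fin 2, ∑ k : Fin 2, ∑ l : Fin 2, p i j k l) = 1 ∧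
      linkEqs p qq.1 qq.2}


/-- The constraint set for the optimization defining the bound: nonnegative
counterfactual probabilities summing to one and linked to `(q0, q1)` by the eight
identities. -/
def constrSet (q0 q1 : (Fin 2 × Fin 2) → ℝ) :
    Set (Fin 2 → Fin 2 → Fin 2 → Fin 2 → ℝ) :=
  {p | (∀ i j k l, 0 ≤ p i j k l) ∧
    (∑ i : Fin 2, ∑ j : Fin 2, ∑ k : Fin 2, ∑ l : Fin 2, p i j k l) = 1 ∧
    linkEqs p q0 q1}

/-- The value function `g(q̄)`: the minimum of the objective `f` over the constraint
set determined by `q̄`. -/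
noncomputable def gval (f : (Fin 2 → Fin 2 → Fin 2 → Fin 2 → ℝ) → ℝ)
    (qq : ((Fin 2 × Fin 2) → ℝ) × ((Fin 2 × Fin 2) → ℝ)) : ℝ :=
  sInf (f '' constrSet qq.1 qq.2)

/-- The Dirichlet shape vector `(1, c)` associated with a table of counts `c`. -/
def shapeOf (c : (Fin 2 × Fin 2) → ℕ) : Option (Fin 2 × Fin 2) → ℝ :=
  fun o => o.elim 1 (fun ay => (c ay : ℝ))

/-- The eight inequality constraints obtained from the identities by replacing each
observable probability `q_{zay}` by the fiducial value `V*_{zay}` and `=` by `≥`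
(i.e. `V*_{zay}` is at most the corresponding sum of four counterfactual
probabilities). -/
def linkIneqs (p : Fin 2 → Fin 2 → Fin 2 → Fin 2 → ℝ)
    (v0 v1 : Fin 2 × Fin 2 → ℝ) : Prop :=
  v0 (0, 0) ≤ p 0 0 0 1 + p 0 0 0 0 + p 0 1 0 1 + p 0 1 0 0 ∧
  v0 (0, 1) ≤ p 0 0 1 0 + p 0 0 1 1 + p 0 1 1 1 + p 0 1 1 0 ∧
  v0 (1, 0) ≤ p 1 1 1 0 + p 1 1 0 0 + p 1 0 1 0 + p 1 0 0 0 ∧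
  v0 (1, 1) ≤ p 1 1 0 1 + p 1 1 1 1 + p 1 0 1 1 + p 1 0 0 1 ∧
  v1 (0, 0) ≤ p 0 0 0 1 + p 0 0 0 0 + p 1 0 0 1 + p 1 0 0 0 ∧
  v1 (0, 1) ≤ p 0 0 1 0 + p 0 0 1 1 + p 1 0 1 1 + p 1 0 1 0 ∧
  v1 (1, 0) ≤ p 1 1 1 0 + p 1 1 0 0 + p 0 1 1 0 + p 0 1 0 0 ∧
  v1 (1, 1) ≤ p 1 1 0 1 + p 1 1 1 1 + p 0 1 1 1 + p 0 1 0 1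

/-- The fiducial optimum `G*`: the minimum of the objective `f` over nonnegative
counterfactual probabilities summing to one and satisfying the eight fiducial
inequality constraints. -/
noncomputable def GstarVal (f : (Fin 2 → Fin 2 → Fin 2 → Fin 2 → ℝ) → ℝ)
    (v0 v1 : Fin 2 × Fin 2 → ℝ) : ℝ :=
  sInf (f '' {p | (∀ i j k l, 0 ≤ p i j k l) ∧
    (∑ i : Fin 2, ∑ j : Fin 2, ∑ k : Fin 2, ∑ l : Fin 2, p i j k l) = 1 ∧
    linkIneqs p v0 v1})

section Helpers
open Asymptotics

lemma aux_norm_pow_exp (k : ℕ) (r : ℂ) (x : ℝ) (hx : 0 ≤ x) :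
    ‖((x : ℂ) ^ k) * Complex.exp (-(r * x))‖ = x ^ k * Real.exp (-(r.re * x)) := by
  rw [norm_mul, norm_pow, Complex.norm_exp, Complex.norm_real, Real.norm_of_nonneg hx]
  simp

lemma aux_integrable (k : ℕ) {b : ℝ} (hb : 0 < b) :
    IntegrableOn (fun x : ℝ => x ^ k * Real.exp (-(b * x))) (Set.Ioi 0) := by
  have h := integrableOn_rpow_mul_exp_neg_mul_rpow (s := (k : ℝ)) (p := 1) (b := b)
    (by have : (0 : ℝ) ≤ k := Nat.cast_nonneg k
        linarith) one_pos hb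
  refine h.congr_fun (fun x _ => ?_) measurableSet_Ioi
  simp

lemma aux_integrable_complex (k : ℕ) {r : ℂ} (hr : 0 < r.re) :
    IntegrableOn (fun x : ℝ => ((x : ℂ) ^ k) * Complex.exp (-(r * x))) (Set.Ioi 0) := by
  refine (aux_integrable k hr).mono' (by fun_prop) ?_
  filter_upwards [self_mem_ae_restrict measurableSet_Ioi] with x hx
  rw [aux_norm_pow_exp k r x (le_of_lt hx)]

lemma aux_tendsto (k : ℕ) {r : ℂ} (hr : 0 < r.re) :
    Tendsto (fun x : ℝ => ((x : ℂ) ^ k) * Complex.exp (-(r * x))) atTop (𝓝 0) := by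
  rw [tendsto_zero_iff_norm_tendsto_zero]
  have h := tendsto_rpow_mul_exp_neg_mul_atTop_nhds_zero (k : ℝ) r.re hr
  refine h.congr' ?_
  filter_upwards [eventually_ge_atTop 0] with x hx
  rw [aux_norm_pow_exp k r x hx]
  simp

/-- The complex Gamma integral with natural exponent. -/
lemma integral_pow_mul_cexp (k : ℕ) {r : ℂ} (hr : 0 < r.re) :
    ∫ x : ℝ in Set.Ioi 0, ((x : ℂ) ^ k) * Complex.exp (-(r * x)) =
      (k.factorial : ℂ) * (r⁻¹) ^ (k + 1) := by
  have hr0 : r ≠ 0 := by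
    rintro rfl
    simp at hr
  have hlin : ∀ x : ℝ, HasDerivAt (fun x : ℝ => -(r * (x : ℂ))) (-r) x := by
    intro x
    have := ((Complex.ofRealCLM.hasDerivAt (x := x)).const_mul r).neg
    simpa using! this
  induction k with
  | zero =>
    have h := integral_Ioi_of_hasDerivAt_of_tendsto (a := 0) (m := 0)
      (f := fun x : ℝ => -(r⁻¹) * (((x : ℂ) ^ 0) * Complex.exp (-(r * x))))
      (f' := fun x : ℝ => ((x : ℂ) ^ 0) * Complex.exp (-(r * x))) (by fun_prop) ?_
      (aux_integrable_complex 0 hr) ?_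
    · rw [h]
      simp
    · intro x _
      have := ((hlin x).cexp).const_mul (-r⁻¹)
      simp only [pow_zero, one_mul]
      refine this.congr_deriv ?_
      field_simp
    · simpa using (aux_tendsto 0 hr).const_mul (-r⁻¹)
  | succ k ih =>
    have h := integral_Ioi_of_hasDerivAt_of_tendsto (a := 0) (m := 0)
      (f := fun x : ℝ => (((x : ℂ) ^ (k + 1)) * Complex.exp (-(r * x))))
      (f' := fun x : ℝ => (k + 1 : ℂ) * (((x : ℂ) ^ k) * Complex.exp (-(r * x))) -
          r * (((x : ℂ) ^ (k + 1)) * Complex.exp (-(r * x)))) (by fun_prop) ?_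
      (((aux_integrable_complex k hr).const_mul _).sub
        ((aux_integrable_complex (k + 1) hr).const_mul _)) ?_
    · rw [integral_sub ((aux_integrable_complex k hr).const_mul _)
        ((aux_integrable_complex (k + 1) hr).const_mul _), integral_const_mul,
        integral_const_mul, ih] at h
      simp only [Complex.ofReal_zero, ne_eq, Nat.add_eq_zero_iff, one_ne_zero, and_false,
        not_false_eq_true, zero_pow, zero_mul, sub_zero] at h
      have h2 := sub_eq_zero.mp h
      rw [Nat.factorial_succ]
      push_cast
      have h3 := congrArg (fun z => r⁻¹ * z) h2
      simp only [inv_mul_cancel_left₀ hr0] at h3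
      rw [← h3]
      ring
    · intro x _
      have hp : HasDerivAt (fun x : ℝ => ((x : ℂ) ^ (k + 1))) ((k + 1 : ℂ) * (x : ℂ) ^ k) x := by
        have := (Complex.ofRealCLM.hasDerivAt (x := x)).pow (k + 1)
        simpa using! this
      have := hp.mul ((hlin x).cexp)
      refine this.congr_deriv ?_
      ring
    · exact aux_tendsto (k + 1) hr

lemma integral_pow_mul_rexp (k : ℕ) :
    ∫ x : ℝ in Set.Ioi 0, x ^ k * Real.exp (-x) = (k.factorial : ℝ) := by
  have h := integral_pow_mul_cexp k (r := 1) (by simp)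
  have h2 : ∫ x : ℝ in Set.Ioi 0, ((x : ℂ) ^ k) * Complex.exp (-(1 * x)) =
      ∫ x : ℝ in Set.Ioi 0, ((x ^ k * Real.exp (-x) : ℝ) : ℂ) := by
    congr 1
    ext x
    push_cast
    simp
  rw [h2, integral_complex_ofReal] at h
  simp only [inv_one, one_pow, mul_one] at h
  exact_mod_cast h

lemma gammaShape_succ (k : ℕ) : gammaShape ((k + 1 : ℕ) : ℝ) = gammaMeasure ((k + 1 : ℕ) : ℝ) 1 := by
  have : ((k + 1 : ℕ) : ℝ) ≠ 0 := by positivity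
  simp only [gammaShape, this, if_false]

lemma gammaShape_zero : gammaShape ((0 : ℕ) : ℝ) = Measure.dirac 0 := by
  simp [gammaShape]

instance gammaShape_prob (c : ℕ) : IsProbabilityMeasure (gammaShape (c : ℝ)) := by
  cases c with
  | zero => rw [gammaShape_zero]; infer_instance
  | succ k =>
    rw [gammaShape_succ]
    exact isProbabilityMeasure_gammaMeasure (by positivity) one_pos

lemma gammaPDFReal_nat (k : ℕ) {x : ℝ} (hx : 0 < x) :
    gammaPDFReal ((k + 1 : ℕ) : ℝ) 1 x = (k.factorial : ℝ)⁻¹ * (x ^ k * Real.exp (-x)) := by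
  have h : Real.Gamma ((k : ℝ) + 1) = k.factorial := Real.Gamma_nat_eq_factorial k
  simp only [gammaPDFReal, hx.le, if_true]
  push_cast
  rw [h]
  simp only [Real.one_rpow, one_mul, add_sub_cancel_right, Real.rpow_natCast]
  ring

lemma integral_gammaShape {E : Type*} [NormedAddCommGroup E] [NormedSpace ℝ E]
    (k : ℕ) (h : ℝ → E) :
    ∫ x, h x ∂(gammaShape ((k + 1 : ℕ) : ℝ)) =
      ∫ x in Set.Ioi (0 : ℝ), ((k.factorial : ℝ)⁻¹ * (x ^ k * Real.exp (-x))) • h x := by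
  rw [gammaShape_succ, gammaMeasure,
    integral_withDensity_eq_integral_toReal_smul (f := gammaPDF ((k + 1 : ℕ) : ℝ) 1)
      ((measurable_gammaPDFReal _ _).ennreal_ofReal)
      (ae_of_all _ fun x => by simp [gammaPDF])]
  have h0 : ∀ x : ℝ, (gammaPDF ((k + 1 : ℕ) : ℝ) 1 x).toReal =
      gammaPDFReal ((k + 1 : ℕ) : ℝ) 1 x := fun x => by
    rw [gammaPDF, ENNReal.toReal_ofReal (gammaPDFReal_nonneg (by positivity) one_pos x)]
  simp only [h0]
  rw [← integral_Ici_eq_integral_Ioi, ← integral_indicator measurableSet_Ici]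
  have hset : (fun x => gammaPDFReal ((k + 1 : ℕ) : ℝ) 1 x • h x) =ᵐ[volume]
     (Set.Ici (0 : ℝ)).indicator
      fun x => ((k.factorial : ℝ)⁻¹ * (x ^ k * Real.exp (-x))) • h x := by
    have : ∀ᵐ x : ℝ, x ≠ 0 := by
      simp [ae_iff]
    filter_upwards [this] with x hx
    by_cases hx0 : 0 ≤ x
    · rw [Set.indicator_of_mem (by exact hx0), gammaPDFReal_nat k (lt_of_le_of_ne hx0 hx.symm)]
    · rw [Set.indicator_of_notMem (by simpa using hx0)]
      simp [gammaPDFReal, hx0]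
  exact integral_congr_ae hset

lemma charFun_gammaShape (c : ℕ) (t : ℝ) :
    charFun (gammaShape (c : ℝ)) t = ((1 - t * Complex.I)⁻¹) ^ c := by
  rw [charFun_apply_real]
  cases c with
  | zero => rw [gammaShape_zero]; simp
  | succ k =>
    rw [integral_gammaShape]
    have h := integral_pow_mul_cexp k (r := 1 - t * Complex.I) (by simp)
    have h2 : ∀ x : ℝ, ((k.factorial : ℝ)⁻¹ * (x ^ k * Real.exp (-x))) •
        Complex.exp (t * x * Complex.I) =
        (k.factorial : ℂ)⁻¹ * (((x : ℂ) ^ k) * Complex.exp (-((1 - t * Complex.I) * x))) := by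
      intro x
      have : Complex.exp (-((1 - t * Complex.I) * x)) =
          Complex.exp (-x) * Complex.exp (t * x * Complex.I) := by
        rw [← Complex.exp_add]
        congr 1
        ring
      rw [this, Complex.real_smul]
      push_cast
      ring
    simp only [h2]
    rw [integral_const_mul, h, inv_mul_cancel_left₀]
    exact_mod_cast Nat.factorial_ne_zero k

lemma gammaShape_nonneg (c : ℕ) : ∀ᵐ x ∂(gammaShape (c : ℝ)), 0 ≤ x := by
  cases c with
  | zero => rw [gammaShape_zero]; simp [ae_dirac_eq]
  | succ k =>
    rw [gammaShape_succ, ae_iff, gammaMeasure]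
    have : {a : ℝ | ¬ 0 ≤ a} = Set.Iio 0 := by ext; simp
    rw [this, withDensity_apply _ measurableSet_Iio, lintegral_gammaPDF_of_nonpos le_rfl]

lemma gammaShape_second (k : ℕ) :
    ∫ x, (x - ((k + 1 : ℕ) : ℝ)) ^ 2 ∂(gammaShape ((k + 1 : ℕ) : ℝ)) = ((k + 1 : ℕ) : ℝ) := by
  rw [integral_gammaShape]
  have hI : ∀ j : ℕ, IntegrableOn (fun x : ℝ => x ^ j * Real.exp (-x)) (Set.Ioi 0) := fun j => by
    simpa using aux_integrable j one_pos
  have h2 : ∀ x : ℝ, ((k.factorial : ℝ)⁻¹ * (x ^ k * Real.exp (-x))) •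
      (x - ((k + 1 : ℕ) : ℝ)) ^ 2 =
      (k.factorial : ℝ)⁻¹ * (x ^ (k + 2) * Real.exp (-x)) -
      (k.factorial : ℝ)⁻¹ * (2 * (k + 1)) * (x ^ (k + 1) * Real.exp (-x)) +
      (k.factorial : ℝ)⁻¹ * (k + 1) ^ 2 * (x ^ k * Real.exp (-x)) := by
    intro x
    rw [smul_eq_mul]
    push_cast
    ring
  simp only [h2]
  rw [integral_add (by exact ((hI _).const_mul _).sub ((hI _).const_mul _)) ((hI _).const_mul _),
    integral_sub ((hI _).const_mul _) ((hI _).const_mul _), integral_const_mul,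
    integral_const_mul, integral_const_mul, integral_pow_mul_rexp, integral_pow_mul_rexp,
    integral_pow_mul_rexp, Nat.factorial_succ (k + 1), Nat.factorial_succ k]
  have : (k.factorial : ℝ) ≠ 0 := by exact_mod_cast Nat.factorial_ne_zero k
  push_cast
  field_simp
  ring

lemma gammaShape_cheb (c : ℕ) {K : ℝ} (hK : 0 < K) :
    gammaShape (c : ℝ) {x | K < |x - c|} ≤ ENNReal.ofReal (c / K ^ 2) := by
  cases c with
  | zero =>
    rw [gammaShape_zero, Measure.dirac_apply' _ (measurableSet_lt (by fun_prop) (by fun_prop))]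
    simp [hK.le]
  | succ k =>
    have hs := gammaShape_second k
    have hint : Integrable (fun x : ℝ => (x - ((k + 1 : ℕ) : ℝ)) ^ 2)
        (gammaShape ((k + 1 : ℕ) : ℝ)) := by
      by_contra hcon
      rw [integral_undef hcon] at hs
      have : (0 : ℝ) < ((k + 1 : ℕ) : ℝ) := by positivity
      linarith
    have hm := mul_meas_ge_le_integral_of_nonneg (ae_of_all _ fun x => sq_nonneg _) hint (K ^ 2)
    rw [hs] at hm
    have hsub : {x : ℝ | K < |x - ((k + 1 : ℕ) : ℝ)|} ⊆
        {x : ℝ | K ^ 2 ≤ (x - ((k + 1 : ℕ) : ℝ)) ^ 2} := by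
      intro x hx
      have hx' : K < |x - ((k + 1 : ℕ) : ℝ)| := hx
      show K ^ 2 ≤ _
      rw [← sq_abs (x - _)]
      gcongr
    have h3 := (measureReal_mono hsub (measure_ne_top (gammaShape ((k + 1 : ℕ) : ℝ)) _))
    rw [← ofReal_measureReal]
    apply ENNReal.ofReal_le_ofReal
    rw [le_div_iff₀ (by positivity)]
    nlinarith [sq_nonneg K, pow_pos hK 2]

/-- Limit of the characteristic functions of centered Gamma variables. -/
lemma gamma_char_limit (c : ℕ → ℕ) (θ : ℕ → ℝ) (s : ℝ) (hθ : Tendsto θ atTop (𝓝 0))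
    (hc : Tendsto (fun n => (c n : ℝ) * (θ n) ^ 2) atTop (𝓝 s)) :
    Tendsto (fun n => Complex.exp (-(θ n * c n * Complex.I)) *
      ((1 - θ n * Complex.I)⁻¹) ^ (c n)) atTop (𝓝 (Complex.exp (-(s / 2)))) := by
  have key : Tendsto (fun n => (c n : ℂ) * (-(θ n * Complex.I) -
      Complex.log (1 + (-(θ n * Complex.I))))) atTop (𝓝 (-(s / 2))) := by
    have h1 : Tendsto (fun n => (((c n : ℝ) * (θ n) ^ 2 : ℝ) : ℂ) * (-(1 / 2))) atTop
        (𝓝 (-(s / 2))) := by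
      have := ((Complex.continuous_ofReal.tendsto s).comp hc).mul_const (-(1 / 2 : ℂ))
      rw [show (-((s : ℂ) / 2)) = s * (-(1 / 2)) by ring]
      exact this
    have h2 : Tendsto (fun n => ((c n : ℂ) * (-(θ n * Complex.I) -
      Complex.log (1 + (-(θ n * Complex.I))))) - (((c n : ℝ) * (θ n) ^ 2 : ℝ) : ℂ) * (-(1 / 2)))
      atTop (𝓝 0) := by
      rw [tendsto_zero_iff_norm_tendsto_zero]
      have hb : Tendsto (fun n => ((c n : ℝ) * (θ n) ^ 2) * |θ n|) atTop (𝓝 0) := by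
        simpa using hc.mul hθ.abs
      refine squeeze_zero' (Eventually.of_forall fun _ => norm_nonneg _) ?_ hb
      have hsmall : ∀ᶠ n in atTop, |θ n| < 1 / 2 := by
        have := hθ.abs
        simp only [abs_zero] at this
        exact this.eventually (gt_mem_nhds (by norm_num))
      filter_upwards [hsmall] with n hn
      have hnorm : ‖-((θ n : ℂ) * Complex.I)‖ = |θ n| := by simp
      have := Complex.norm_log_sub_logTaylor_le 2 (z := -(θ n * Complex.I))
        (by rw [hnorm]; linarith)
      rw [hnorm] at this
      simp only [Complex.logTaylor_succ, Complex.logTaylor_zero] at this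
      have heq : ((c n : ℂ) * (-(θ n * Complex.I) -
      Complex.log (1 + (-(θ n * Complex.I))))) - (((c n : ℝ) * (θ n) ^ 2 : ℝ) : ℂ) * (-(1 / 2))
        = -((c n : ℂ) * (Complex.log (1 + (-(θ n * Complex.I))) - (-(θ n * Complex.I) -
          (-(θ n * Complex.I)) ^ 2 / 2))) := by
        push_cast
        have hI : Complex.I ^ 2 = -1 := Complex.I_sq
        linear_combination ((1 / 2) * (c n : ℂ) * (θ n : ℂ) ^ 2) * hI
      rw [heq, norm_neg, norm_mul]
      have hle : ‖Complex.log (1 + (-(θ n * Complex.I))) - (-(θ n * Complex.I) -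
          (-(θ n * Complex.I)) ^ 2 / 2)‖ ≤ |θ n| ^ 3 := by
        have e : ∀ w L : ℂ, L - (w - w ^ 2 / 2) = L - (0 + (-1 : ℂ) ^ (0 + 1) * w ^ 0 / ((0 : ℕ) : ℂ) +
            (-1 : ℂ) ^ (1 + 1) * w ^ 1 / ((1 : ℕ) : ℂ) +
            (-1 : ℂ) ^ (2 + 1) * w ^ 2 / ((2 : ℕ) : ℂ)) := by
          intro w L
          push_cast
          simp
          ring
        rw [e]
        refine this.trans ?_
        have hinv : (1 - |θ n|)⁻¹ ≤ 2 := by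
          rw [inv_le_comm₀ (by linarith) (by norm_num)]
          linarith
        have h3 : (0 : ℝ) ≤ |θ n| ^ 3 := by positivity
        norm_num
        nlinarith
      calc ‖(c n : ℂ)‖ * _ ≤ (c n : ℝ) * |θ n| ^ 3 := by
            rw [Complex.norm_natCast]; gcongr
        _ = _ := by rw [← sq_abs (θ n)]; ring
    have := h2.add h1
    simpa using this
  have h3 := (Complex.continuous_exp.tendsto _).comp key
  refine h3.congr fun n => ?_
  have hne : (1 + -((θ n : ℂ) * Complex.I)) ≠ 0 := by
    intro h
    have := congrArg Complex.re h
    simp at this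
  simp only [Function.comp_apply]
  rw [mul_sub, Complex.exp_sub, Complex.exp_nat_mul _ (c n), Complex.exp_nat_mul _ (c n),
    Complex.exp_log hne, ← sub_eq_add_neg, inv_pow, ← Complex.exp_nat_mul, div_eq_mul_inv]
  congr 2
  ring


/-- shorthand for the space of counterfactual probability tables -/
abbrev PTab := Fin 2 → Fin 2 → Fin 2 → Fin 2 → ℝ
/-- shorthand for the category index type -/
abbrev Cat := Fin 2 × Fin 2

/-- The observable margin for `z = 0`. -/
def marg0 (p : PTab) : Cat → ℝ := fun ay =>
  ![![p 0 0 0 1 + p 0 0 0 0 + p 0 1 0 1 + p 0 1 0 0,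
      p 0 0 1 0 + p 0 0 1 1 + p 0 1 1 1 + p 0 1 1 0],
    ![p 1 1 1 0 + p 1 1 0 0 + p 1 0 1 0 + p 1 0 0 0,
      p 1 1 0 1 + p 1 1 1 1 + p 1 0 1 1 + p 1 0 0 1]] ay.1 ay.2

/-- The observable margin for `z = 1`. -/
def marg1 (p : PTab) : Cat → ℝ := fun ay =>
  ![![p 0 0 0 1 + p 0 0 0 0 + p 1 0 0 1 + p 1 0 0 0,
      p 0 0 1 0 + p 0 0 1 1 + p 1 0 1 1 + p 1 0 1 0],
    ![p 1 1 1 0 + p 1 1 0 0 + p 0 1 1 0 + p 0 1 0 0,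
      p 1 1 0 1 + p 1 1 1 1 + p 0 1 1 1 + p 0 1 0 1]] ay.1 ay.2

/-- The compact set of probability tables. -/
def PSimp : Set PTab := {p | (∀ i j k l, 0 ≤ p i j k l) ∧
    (∑ i : Fin 2, ∑ j : Fin 2, ∑ k : Fin 2, ∑ l : Fin 2, p i j k l) = 1}

lemma linkEqs_iff (p : PTab) (q0 q1 : Cat → ℝ) :
    linkEqs p q0 q1 ↔ q0 = marg0 p ∧ q1 = marg1 p := by
  simp only [linkEqs, marg0, marg1, funext_iff, Prod.forall, Fin.forall_fin_two]
  simp [and_assoc]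

lemma linkIneqs_iff (p : PTab) (q0 q1 : Cat → ℝ) :
    linkIneqs p q0 q1 ↔ q0 ≤ marg0 p ∧ q1 ≤ marg1 p := by
  simp only [linkIneqs, marg0, marg1, Pi.le_def, Prod.forall, Fin.forall_fin_two]
  simp [and_assoc]

lemma marg0_mem {p : PTab} (hp : p ∈ PSimp) : marg0 p ∈ stdSimplex ℝ Cat := by
  obtain ⟨h0, h1⟩ := hp
  constructor
  · rintro ⟨a, y⟩
    fin_cases a <;> fin_cases y <;> simp [marg0] <;>
      linarith [h0 0 0 0 0, h0 0 0 0 1, h0 0 0 1 0, h0 0 0 1 1, h0 0 1 0 0, h0 0 1 0 1, h0 0 1 1 0,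
        h0 0 1 1 1, h0 1 0 0 0, h0 1 0 0 1, h0 1 0 1 0, h0 1 0 1 1, h0 1 1 0 0, h0 1 1 0 1,
        h0 1 1 1 0, h0 1 1 1 1]
  · simp [Fin.sum_univ_two] at h1
    simp [Fintype.sum_prod_type, marg0]
    linarith

lemma marg1_mem {p : PTab} (hp : p ∈ PSimp) : marg1 p ∈ stdSimplex ℝ Cat := by
  obtain ⟨h0, h1⟩ := hp
  constructor
  · rintro ⟨a, y⟩
    fin_cases a <;> fin_cases y <;> simp [marg1] <;>
      linarith [h0 0 0 0 0, h0 0 0 0 1, h0 0 0 1 0, h0 0 0 1 1, h0 0 1 0 0, h0 0 1 0 1, h0 0 1 1 0,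
        h0 0 1 1 1, h0 1 0 0 0, h0 1 0 0 1, h0 1 0 1 0, h0 1 0 1 1, h0 1 1 0 0, h0 1 1 0 1,
        h0 1 1 1 0, h0 1 1 1 1]
  · simp [Fin.sum_univ_two] at h1
    simp [Fintype.sum_prod_type, marg1]
    linarith

lemma continuous_marg0 : Continuous marg0 := by
  refine continuous_pi ?_
  rintro ⟨a, y⟩
  fin_cases a <;> fin_cases y <;> simp [marg0] <;> fun_prop

lemma continuous_marg1 : Continuous marg1 := by
  refine continuous_pi ?_
  rintro ⟨a, y⟩
  fin_cases a <;> fin_cases y <;> simp [marg1] <;> fun_prop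

lemma isCompact_PSimp : IsCompact PSimp := by
  have hc : IsCompact (Set.univ.pi fun _ : Fin 2 => Set.univ.pi fun _ : Fin 2 =>
      Set.univ.pi fun _ : Fin 2 => Set.univ.pi fun _ : Fin 2 => Set.Icc (0 : ℝ) 1) :=
    isCompact_univ_pi fun _ => isCompact_univ_pi fun _ => isCompact_univ_pi fun _ =>
      isCompact_univ_pi fun _ => isCompact_Icc
  refine hc.of_isClosed_subset ?_ ?_
  · have : PSimp = (⋂ i, ⋂ j, ⋂ k, ⋂ l, {p : PTab | 0 ≤ p i j k l}) ∩ {p : PTab |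
      (∑ i : Fin 2, ∑ j : Fin 2, ∑ k : Fin 2, ∑ l : Fin 2, p i j k l) = 1} := by
      ext p
      simp [PSimp]
    rw [this]
    refine IsClosed.inter ?_ (isClosed_eq (by fun_prop) (by fun_prop))
    exact isClosed_iInter fun i => isClosed_iInter fun j => isClosed_iInter fun k =>
      isClosed_iInter fun l => isClosed_le (by fun_prop) (by fun_prop)
  · rintro p ⟨h0, h1⟩
    simp only [Set.mem_pi, Set.mem_univ, true_imp_iff, Set.mem_Icc]
    intro i j k l
    refine ⟨h0 i j k l, ?_⟩
    rw [← h1]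
    calc p i j k l ≤ ∑ l, p i j k l :=
          Finset.single_le_sum (f := fun l => p i j k l) (fun l _ => h0 i j k l)
            (Finset.mem_univ l)
      _ ≤ ∑ k, ∑ l, p i j k l :=
          Finset.single_le_sum (f := fun k => ∑ l, p i j k l)
            (fun k _ => Finset.sum_nonneg fun l _ => h0 i j k l) (Finset.mem_univ k)
      _ ≤ ∑ j, ∑ k, ∑ l, p i j k l :=
          Finset.single_le_sum (f := fun j => ∑ k, ∑ l, p i j k l)
            (fun j _ => Finset.sum_nonneg fun k _ => Finset.sum_nonneg fun l _ => h0 i j k l)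
            (Finset.mem_univ j)
      _ ≤ _ := Finset.single_le_sum (f := fun i => ∑ j, ∑ k, ∑ l, p i j k l)
            (fun i _ => Finset.sum_nonneg fun j _ => Finset.sum_nonneg fun k _ =>
              Finset.sum_nonneg fun l _ => h0 i j k l) (Finset.mem_univ i)

lemma GstarVal_eq (f : PTab → ℝ) (v0 v1 : Cat → ℝ) :
    GstarVal f v0 v1 = sInf (f '' {p | p ∈ PSimp ∧ (v0, v1) ≤ (marg0 p, marg1 p)}) := by
  unfold GstarVal
  congr 2
  ext p
  simp only [Set.mem_ofPred_eq, linkIneqs_iff, PSimp, and_assoc, Prod.mk_le_mk]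

lemma gval_eq (f : PTab → ℝ) (u : (Cat → ℝ) × (Cat → ℝ)) :
    gval f u = sInf (f '' {p | p ∈ PSimp ∧ u = (marg0 p, marg1 p)}) := by
  unfold gval constrSet
  congr 2
  ext p
  simp only [Set.mem_ofPred_eq, linkEqs_iff, PSimp, and_assoc, Prod.ext_iff]

lemma bddBelow_PSimp {f : PTab → ℝ} (hf : Continuous f) {s : Set PTab} (hs : s ⊆ PSimp) :
    BddBelow (f '' s) :=
  ((isCompact_PSimp.image hf).bddBelow).mono (Set.image_mono hs)

lemma isClosed_down {f : PTab → ℝ} (hf : Continuous f) (c : ℝ) :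
    IsClosed {v : (Cat → ℝ) × (Cat → ℝ) | ∃ p, p ∈ PSimp ∧ v ≤ (marg0 p, marg1 p) ∧ f p ≤ c} := by
  have hc : IsCompact ((fun p => (marg0 p, marg1 p)) '' (PSimp ∩ {p | f p ≤ c})) :=
    (isCompact_PSimp.inter_right (isClosed_le hf continuous_const)).image
      (continuous_marg0.prodMk continuous_marg1)
  have h2 := IsClosed.add_left_of_isCompact (isClosed_Iic (a := (0 : (Cat → ℝ) × (Cat → ℝ)))) hc
  convert h2 using 1
  ext v
  simp only [Set.mem_ofPred_eq, Set.mem_add, Set.mem_image, Set.mem_inter_iff, Set.mem_Iic]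
  constructor
  · rintro ⟨p, hp, hv, hfp⟩
    exact ⟨_, ⟨p, ⟨hp, hfp⟩, rfl⟩, v - (marg0 p, marg1 p), sub_nonpos.mpr hv, by abel⟩
  · rintro ⟨_, ⟨p, ⟨hp, hfp⟩, rfl⟩, w, hw, rfl⟩
    exact ⟨p, hp, by simpa using! add_le_add_right hw (marg0 p, marg1 p), hfp⟩

lemma measurable_GstarVal {f : PTab → ℝ} (hf : Continuous f) :
    Measurable fun v : (Cat → ℝ) × (Cat → ℝ) => GstarVal f v.1 v.2 := by
  refine measurable_of_Iic fun c => ?_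
  have hFc : IsClosed {v : (Cat → ℝ) × (Cat → ℝ) | ∃ p, p ∈ PSimp ∧ v ≤ (marg0 p, marg1 p)} := by
    simpa using isClosed_down (f := fun _ => 0) continuous_const 0
  have : (fun v : (Cat → ℝ) × (Cat → ℝ) => GstarVal f v.1 v.2) ⁻¹' Set.Iic c =
      {v | ∃ p, p ∈ PSimp ∧ v ≤ (marg0 p, marg1 p) ∧ f p ≤ c} ∪
      ({v | ∃ p, p ∈ PSimp ∧ v ≤ (marg0 p, marg1 p)}ᶜ ∩ {_v | 0 ≤ c}) := by
    ext v
    simp only [Set.mem_preimage, Set.mem_Iic, GstarVal_eq, Set.mem_union, Set.mem_inter_iff,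
      Set.mem_compl_iff, Set.mem_ofPred_eq, Prod.mk.eta]
    by_cases hne : ∃ p, p ∈ PSimp ∧ v ≤ (marg0 p, marg1 p)
    · simp only [hne, not_true_eq_false, false_and, or_false]
      have hcomp : IsCompact {p | p ∈ PSimp ∧ v ≤ (marg0 p, marg1 p)} :=
        isCompact_PSimp.inter_right
          (isClosed_le continuous_const (continuous_marg0.prodMk continuous_marg1))
      constructor
      · intro hle
        obtain ⟨p, hp, hpe⟩ := (hcomp.image hf).sInf_mem ((Set.Nonempty.image _ hne))
        exact ⟨p, hp.1, hp.2, hpe.trans_le hle⟩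
      · rintro ⟨p, hp, hv, hfp⟩
        have hmem : p ∈ {p | p ∈ PSimp ∧ v ≤ (marg0 p, marg1 p)} := ⟨hp, hv⟩
        exact (csInf_le (bddBelow_PSimp hf fun _ h => h.1)
          (Set.mem_image_of_mem f hmem)).trans hfp
    · have hemp : {p | p ∈ PSimp ∧ v ≤ (marg0 p, marg1 p)} = ∅ := by
        ext p
        simp only [Set.mem_ofPred_eq, Set.mem_empty_iff_false, iff_false]
        exact fun h => hne ⟨p, h⟩
      rw [hemp]
      simp only [Set.image_empty, Real.sInf_empty]
      constructor
      · exact fun h => Or.inr ⟨hne, h⟩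
      · rintro (⟨p, hp, hv, _⟩ | ⟨_, h⟩)
        · exact absurd ⟨p, hp, hv⟩ hne
        · exact h
  rw [this]
  exact (isClosed_down hf c).measurableSet.union
    (hFc.measurableSet.compl.inter (MeasurableSet.const _))

lemma norm_sub_le_of_simplex {v u : Cat → ℝ} {r : ℝ} (hsum : ∑ i, v i = 1 - r)
    (hu : u ∈ stdSimplex ℝ Cat) (hvu : v ≤ u) : ‖u - v‖ ≤ r := by
  have hr : ∑ i, (u i - v i) = r := by
    rw [Finset.sum_sub_distrib, hsum, hu.2]; ring
  have hr0 : 0 ≤ r := by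
    rw [← hr]
    exact Finset.sum_nonneg fun i _ => sub_nonneg.mpr (hvu i)
  rw [pi_norm_le_iff_of_nonneg hr0]
  intro i
  rw [Pi.sub_apply, Real.norm_of_nonneg (sub_nonneg.mpr (hvu i)), ← hr]
  exact Finset.single_le_sum (f := fun i => u i - v i)
    (fun i _ => sub_nonneg.mpr (hvu i)) (Finset.mem_univ i)

lemma add_single_mem {v : Cat → ℝ} {r : ℝ} (hr : 0 ≤ r) (hv : 0 ≤ v)
    (hsum : ∑ i, v i = 1 - r) : v + Pi.single (0, 0) r ∈ stdSimplex ℝ Cat ∧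
      v ≤ v + Pi.single (0, 0) r := by
  have h0 : (0 : Cat → ℝ) ≤ Pi.single (0, 0) r := by
    rw [Pi.single_nonneg]; exact hr
  refine ⟨⟨fun i => add_nonneg (hv i) (h0 i), ?_⟩, by simpa using h0⟩
  simp only [Pi.add_apply, Finset.sum_add_distrib, hsum]
  rw [Finset.sum_pi_single']
  simp

/-- Deterministic expansion of the fiducial optimum. -/
lemma Gstar_bound {f : PTab → ℝ} (hf : Continuous f)
    {G : (Cat → ℝ) × (Cat → ℝ) → ℝ} {U : Set ((Cat → ℝ) × (Cat → ℝ))}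
    (hUF : U ∩ (stdSimplex ℝ Cat ×ˢ stdSimplex ℝ Cat) ⊆ Feas)
    (hGg : ∀ qq ∈ U ∩ (stdSimplex ℝ Cat ×ˢ stdSimplex ℝ Cat), G qq = gval f qq)
    {q : (Cat → ℝ) × (Cat → ℝ)} {G' : ((Cat → ℝ) × (Cat → ℝ)) →L[ℝ] ℝ} {δ η : ℝ}
    (hη : 0 ≤ η) (hball : Metric.ball q δ ⊆ U)
    (hlin : ∀ x ∈ Metric.ball q δ, ∀ y ∈ Metric.ball q δ,
      |G x - G y - G' (x - y)| ≤ η * ‖x - y‖)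
    {v w : (Cat → ℝ) × (Cat → ℝ)} {r0 r1 : ℝ} (hr0 : 0 ≤ r0) (hr1 : 0 ≤ r1)
    (hv0 : 0 ≤ v.1) (hv1 : 0 ≤ v.2) (hs0 : ∑ i, v.1 i = 1 - r0) (hs1 : ∑ i, v.2 i = 1 - r1)
    (hvq : ‖v - q‖ + (r0 + r1) < δ) (hw0 : w.1 ∈ stdSimplex ℝ Cat) (hw1 : w.2 ∈ stdSimplex ℝ Cat)
    (hwq : w ∈ Metric.ball q δ) :
    |GstarVal f v.1 v.2 - gval f w - G' (v - w)| ≤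
      η * (‖v - w‖ + (r0 + r1)) + ‖G'‖ * (r0 + r1) := by
  set R := η * (‖v - w‖ + (r0 + r1)) + ‖G'‖ * (r0 + r1) with hR
  have hGw : gval f w = G w := (hGg w ⟨hball hwq, hw0, hw1⟩).symm
  have key : ∀ u : (Cat → ℝ) × (Cat → ℝ), u.1 ∈ stdSimplex ℝ Cat → u.2 ∈ stdSimplex ℝ Cat →
      v ≤ u → u ∈ Metric.ball q δ ∧ |G u - G w - G' (v - w)| ≤ R := by
    intro u hu0 hu1 hvu
    have hn : ‖u - v‖ ≤ r0 + r1 := by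
      rw [Prod.norm_def]
      refine max_le ?_ ?_
      · have := norm_sub_le_of_simplex hs0 hu0 hvu.1
        simp only [Prod.fst_sub]; linarith
      · have := norm_sub_le_of_simplex hs1 hu1 hvu.2
        simp only [Prod.snd_sub]; linarith
    have hub : u ∈ Metric.ball q δ := by
      rw [mem_ball_iff_norm]
      have : u - q = (u - v) + (v - q) := by abel
      rw [this]
      linarith [norm_add_le (u - v) (v - q)]
    refine ⟨hub, ?_⟩
    have h1 := hlin u hub w hwq
    have h2 : ‖u - w‖ ≤ ‖v - w‖ + (r0 + r1) := by
      have : u - w = (u - v) + (v - w) := by abel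
      rw [this]
      linarith [norm_add_le (u - v) (v - w)]
    have h3 : |G' (u - v)| ≤ ‖G'‖ * (r0 + r1) := by
      rw [← Real.norm_eq_abs]
      exact (G'.le_opNorm _).trans (by gcongr)
    have h4 : G u - G w - G' (v - w) = (G u - G w - G' (u - w)) + G' (u - v) := by
      have : u - w = (u - v) + (v - w) := by abel
      rw [this, map_add]; ring
    rw [h4]
    refine (abs_add_le _ _).trans ?_
    have : η * ‖u - w‖ ≤ η * (‖v - w‖ + (r0 + r1)) := by gcongr
    linarith
  obtain ⟨hu0, hle0⟩ := add_single_mem hr0 hv0 hs0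
  obtain ⟨hu1, hle1⟩ := add_single_mem hr1 hv1 hs1
  set u : (Cat → ℝ) × (Cat → ℝ) := (v.1 + Pi.single (0, 0) r0, v.2 + Pi.single (0, 0) r1) with hu
  obtain ⟨hub, hubd⟩ := key u hu0 hu1 ⟨hle0, hle1⟩
  obtain ⟨_, _, p, hp0, hp1, hp⟩ := hUF ⟨hball hub, hu0, hu1⟩
  rw [linkEqs_iff] at hp
  have hne : {p | p ∈ PSimp ∧ u = (marg0 p, marg1 p)}.Nonempty :=
    ⟨p, ⟨hp0, hp1⟩, Prod.ext hp.1 hp.2⟩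
  have hsub : {p | p ∈ PSimp ∧ u = (marg0 p, marg1 p)} ⊆
      {p | p ∈ PSimp ∧ (v.1, v.2) ≤ (marg0 p, marg1 p)} := by
    rintro p ⟨h1, h2⟩
    refine ⟨h1, ?_⟩
    rw [← h2]
    exact ⟨hle0, hle1⟩
  have hup : GstarVal f v.1 v.2 ≤ G u := by
    rw [hGg u ⟨hball hub, hu0, hu1⟩, GstarVal_eq, gval_eq]
    exact csInf_le_csInf (bddBelow_PSimp hf fun _ h => h.1) (hne.image f) (Set.image_mono hsub)
  have hlow : G w + G' (v - w) - R ≤ GstarVal f v.1 v.2 := by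
    rw [GstarVal_eq]
    refine le_csInf ((hne.mono hsub).image f) ?_
    rintro _ ⟨p, ⟨hpP, hpv⟩, rfl⟩
    obtain ⟨hb, hbd⟩ := key (marg0 p, marg1 p) (marg0_mem hpP) (marg1_mem hpP) hpv
    have h1 : G (marg0 p, marg1 p) ≤ f p := by
      rw [hGg _ ⟨hball hb, marg0_mem hpP, marg1_mem hpP⟩, gval_eq]
      exact csInf_le (bddBelow_PSimp hf fun _ h => h.1) ⟨p, ⟨hpP, rfl⟩, rfl⟩
    have := (abs_le.mp hbd).1
    linarith
  rw [hGw, abs_le]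
  have := (abs_le.mp hubd).2
  constructor <;> linarith


lemma categorical_prob {q : Cat → ℝ} (hq : q ∈ stdSimplex ℝ Cat) :
    IsProbabilityMeasure (categorical q) := by
  constructor
  simp only [categorical, Measure.coe_finsetSum, Finset.sum_apply, Measure.smul_apply,
    measure_univ, smul_eq_mul, mul_one]
  rw [← ENNReal.ofReal_sum_of_nonneg fun i _ => hq.1 i, hq.2, ENNReal.ofReal_one]

lemma categorical_singleton (q : Cat → ℝ) (j : Cat) :
    categorical q {j} = ENNReal.ofReal (q j) := by
  simp only [categorical, Measure.coe_finsetSum, Finset.sum_apply, Measure.smul_apply,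
    smul_eq_mul, Measure.dirac_apply' _ (measurableSet_singleton j)]
  rw [Finset.sum_eq_single j]
  · simp
  · intro b _ hb
    simp [hb]
  · simp

lemma multinomial_prob {q : Cat → ℝ} (hq : q ∈ stdSimplex ℝ Cat) (n : ℕ) :
    IsProbabilityMeasure (multinomial Cat n q) := by
  have := categorical_prob hq
  exact Measure.isProbabilityMeasure_map (Measurable.of_discrete).aemeasurable

lemma count_cheb {q : Cat → ℝ} (hq : q ∈ stdSimplex ℝ Cat) {n : ℕ} (hn : 0 < n) (j : Cat)
    {δ : ℝ} (hδ : 0 < δ) :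
    (Measure.pi fun _ : Fin n => categorical q)
      {x | δ ≤ |((Finset.univ.filter (fun i => x i = j)).card : ℝ) / n - q j|} ≤
      ENNReal.ofReal (1 / (n * δ ^ 2)) := by
  have := categorical_prob hq
  set I : Cat → ℝ := Set.indicator {j} 1 with hI
  have hmem : MemLp I 2 (categorical q) :=
    (memLp_indicator_const 2 (measurableSet_singleton j) (1 : ℝ) (Or.inr (measure_ne_top _ _)))
  have hEI : ∫ x, I x ∂(categorical q) = q j := by
    rw [hI, integral_indicator_one (measurableSet_singleton j), measureReal_def,
      categorical_singleton, ENNReal.toReal_ofReal (hq.1 j)]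
  have hVI : Var[I; categorical q] ≤ 1 := by
    have hle : Var[I; categorical q] ≤ ∫ x, (I ^ 2) x ∂(categorical q) :=
      variance_le_expectation_sq hmem.aestronglyMeasurable
    have h2 : (I ^ 2) = I := by
      ext x
      simp only [hI, Pi.pow_apply, Set.indicator_apply]
      split_ifs <;> simp
    rw [h2, hEI] at hle
    refine hle.trans ?_
    rw [← hq.2]
    exact Finset.single_le_sum (fun i _ => hq.1 i) (Finset.mem_univ j)
  set P := (Measure.pi fun _ : Fin n => categorical q) with hP
  set S : (Fin n → Cat) → ℝ := ∑ i : Fin n, fun ω => I (ω i) with hS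
  have hmemi : ∀ i : Fin n, MemLp (fun ω : Fin n → Cat => I (ω i)) 2 P := fun i =>
    hmem.comp_measurePreserving (measurePreserving_eval _ i)
  have hSmem : MemLp S 2 P := memLp_finsetSum' _ fun i _ => hmemi i
  have hvar : Var[S; P] ≤ n := by
    rw [hS, hP, variance_sum_pi (X := fun _ : Fin n => I) fun _ => hmem]
    refine (Finset.sum_le_sum fun i _ => hVI).trans ?_
    simp
  have hES : ∫ x, S x ∂P = n * q j := by
    simp only [hS, Finset.sum_apply]
    rw [integral_finsetSum _ fun i _ => (hmemi i).integrable (by norm_num)]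
    have : ∀ i : Fin n, ∫ x, I (x i) ∂P = q j := fun i => by
      rw [← hEI]
      exact integral_comp_eval (μ := fun _ : Fin n => categorical q)
        hmem.aestronglyMeasurable
    simp [this]
  have hcard : ∀ x : Fin n → Cat, ((Finset.univ.filter (fun i => x i = j)).card : ℝ) = S x := by
    intro x
    simp only [hS, hI, Set.indicator_apply, Finset.sum_apply, Set.mem_singleton_iff, Pi.one_apply]
    rw [Finset.sum_boole]
  have hn' : (0 : ℝ) < n := by exact_mod_cast hn
  have hch := meas_ge_le_variance_div_sq hSmem (c := n * δ) (by positivity)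
  rw [hES] at hch
  have hset : {x : Fin n → Cat | δ ≤
      |((Finset.univ.filter (fun i => x i = j)).card : ℝ) / n - q j|} =
      {x | n * δ ≤ |S x - n * q j|} := by
    ext x
    simp only [Set.mem_ofPred_eq, hcard]
    have : S x - n * q j = n * (S x / n - q j) := by field_simp
    rw [this, abs_mul, abs_of_pos hn', mul_le_mul_iff_right₀ hn']
  rw [hset]
  refine hch.trans (ENNReal.ofReal_le_ofReal ?_)
  rw [div_le_div_iff₀ (by positivity) (by positivity)]
  have : (0 : ℝ) ≤ n * δ ^ 2 := by positivity
  calc Var[S; P] * (n * δ ^ 2) ≤ n * (n * δ ^ 2) := by gcongr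
    _ = _ := by ring

lemma multinomial_lln {q : Cat → ℝ} (hq : q ∈ stdSimplex ℝ Cat) {n : ℕ} (hn : 0 < n)
    {δ : ℝ} (hδ : 0 < δ) :
    multinomial Cat n q {c | ¬ (∑ j, c j = n ∧ ∀ j, |(c j : ℝ) / n - q j| < δ)} ≤
      4 * ENNReal.ofReal (1 / (n * δ ^ 2)) := by
  have := categorical_prob hq
  rw [multinomial, Measure.map_apply Measurable.of_discrete (MeasurableSet.of_discrete)]
  have hsub : (fun (x : Fin n → Cat) (j : Cat) => (Finset.univ.filter (fun i => x i = j)).card) ⁻¹'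
      {c | ¬ (∑ j, c j = n ∧ ∀ j, |(c j : ℝ) / n - q j| < δ)} ⊆
      ⋃ j : Cat, {x | δ ≤ |((Finset.univ.filter (fun i => x i = j)).card : ℝ) / n - q j|} := by
    intro x hx
    simp only [Set.mem_preimage, Set.mem_ofPred_eq] at hx
    have hs : ∑ j : Cat, (Finset.univ.filter (fun i => x i = j)).card = n := by
      rw [← Finset.card_eq_sum_card_fiberwise (fun i _ => Finset.mem_coe.mpr (Finset.mem_univ (x i)))]
      simp
    simp only [hs, true_and, not_forall, not_lt] at hx
    simpa using hx
  refine (measure_mono hsub).trans ((measure_iUnion_fintype_le _ _).trans ?_)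
  refine (Finset.sum_le_sum fun j _ => count_cheb hq hn j hδ).trans ?_
  simp

lemma LP_le {Ω : Type*} [MeasurableSpace Ω] (μ : Measure Ω) [IsProbabilityMeasure μ]
    {Y W : Ω → ℝ} (hY : Measurable Y) (hW : Measurable W) {ε : ℝ} (hε : 0 ≤ ε)
    (h : μ {ω | ε < |Y ω - W ω|} ≤ ENNReal.ofReal ε) :
    levyProkhorovEDist (μ.map Y) (μ.map W) ≤ ENNReal.ofReal ε := by
  have := Measure.isProbabilityMeasure_map (μ := μ) hY.aemeasurable
  have := Measure.isProbabilityMeasure_map (μ := μ) hW.aemeasurable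
  refine levyProkhorovEDist_le_of_forall_le _ _ _ fun ε' B hlt htop hB => ?_
  rw [Measure.map_apply hY hB, Measure.map_apply hW Metric.isOpen_thickening.measurableSet]
  have hε' : ε < ε'.toReal := (ENNReal.ofReal_lt_iff_lt_toReal hε htop.ne).mp hlt
  have hsub : Y ⁻¹' B ⊆ W ⁻¹' (Metric.thickening ε'.toReal B) ∪ {ω | ε < |Y ω - W ω|} := by
    intro ω hω
    by_cases hd : ε < |Y ω - W ω|
    · exact Or.inr hd
    · left
      rw [Set.mem_preimage, Metric.mem_thickening_iff]
      refine ⟨Y ω, hω, ?_⟩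
      rw [dist_comm, Real.dist_eq]
      linarith
  calc μ (Y ⁻¹' B) ≤ _ := measure_mono hsub
    _ ≤ _ := measure_union_le _ _
    _ ≤ _ := by gcongr; exact h.trans hlt.le

lemma LP_tendsto (μ : ℕ → Measure ℝ) [∀ n, IsProbabilityMeasure (μ n)] (ν : Measure ℝ)
    [IsProbabilityMeasure ν]
    (h : ∀ t, Tendsto (fun n => charFun (μ n) t) atTop (𝓝 (charFun ν t))) :
    Tendsto (fun n => levyProkhorovEDist (μ n) ν) atTop (𝓝 0) := by
  let μ' : ℕ → ProbabilityMeasure ℝ := fun n => ⟨μ n, inferInstance⟩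
  let ν' : ProbabilityMeasure ℝ := ⟨ν, inferInstance⟩
  have h1 : Tendsto μ' atTop (𝓝 ν') :=
    ProbabilityMeasure.tendsto_of_tendsto_charFun h
  have h2 := (LevyProkhorov.continuous_ofMeasure_probabilityMeasure.tendsto _).comp h1
  rw [tendsto_iff_edist_tendsto_0] at h2
  exact h2


/-- Natural shape vector. -/
def shN (c : Cat → ℕ) : Option Cat → ℕ := fun o => o.elim 1 c

lemma shapeOf_eq (c : Cat → ℕ) (o : Option Cat) : shapeOf c o = (shN c o : ℝ) := by
  cases o <;> simp [shapeOf, shN]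

instance gammaShape_shapeOf_prob (c : Cat → ℕ) (o : Option Cat) :
    IsProbabilityMeasure (gammaShape (shapeOf c o)) := by
  rw [shapeOf_eq]; infer_instance

/-- The good event of Gamma vectors. -/
def Good (K : ℝ) (n : ℕ) (c : Cat → ℕ) : Set (Option Cat → ℝ) :=
  {x | (∀ o, 0 ≤ x o) ∧ |x none - 1| ≤ K ∧ ∀ i, |x (some i) - c i| ≤ K * √n}

lemma good_prob {K : ℝ} (hK : 0 < K) {n : ℕ} (hn : 0 < n) (c : Cat → ℕ) (hc : ∑ i, c i = n) :
    (Measure.pi fun o => gammaShape (shapeOf c o)) (Good K n c)ᶜ ≤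
      5 * ENNReal.ofReal (1 / K ^ 2) := by
  set P := (Measure.pi fun o => gammaShape (shapeOf c o)) with hP
  have hev : ∀ o : Option Cat, ∀ s : Set ℝ, MeasurableSet s →
      P {x | x o ∈ s} = gammaShape (shN c o : ℝ) s := by
    intro o s hs
    rw [← shapeOf_eq]
    exact (measurePreserving_eval (fun o => gammaShape (shapeOf c o)) o).measure_preimage
      hs.nullMeasurableSet
  have hn' : (0 : ℝ) < n := by exact_mod_cast hn
  set κ : Option Cat → ℝ := fun o => o.elim K (fun _ => K * √n) with hκ
  have hκpos : ∀ o, 0 < κ o := by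
    rintro (_ | i) <;> simp only [hκ, Option.elim] <;> positivity
  have hsub : (Good K n c)ᶜ ⊆ {x | ¬ ∀ o, 0 ≤ x o} ∪
      ⋃ o : Option Cat, {x | x o ∈ {y : ℝ | κ o < |y - (shN c o : ℝ)|}} := by
    intro x hx
    by_contra hcon
    apply hx
    simp only [Set.mem_union, Set.mem_iUnion, Set.mem_ofPred_eq, not_or, not_not, not_exists,
      not_lt] at hcon
    refine ⟨hcon.1, ?_, fun i => ?_⟩
    · have := hcon.2 none
      simpa [hκ, shN] using this
    · have := hcon.2 (some i)
      simpa [hκ, shN] using this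
  have h0 : P {x | ¬ ∀ o, 0 ≤ x o} = 0 := by
    rw [← ae_iff]
    rw [ae_all_iff]
    intro o
    rw [ae_iff]
    have := hev o {y | ¬ 0 ≤ y} (measurableSet_le measurable_const measurable_id).compl
    refine this.trans ?_
    exact ae_iff.mp (gammaShape_nonneg _)
  refine (measure_mono hsub).trans ((measure_union_le _ _).trans ?_)
  rw [h0, zero_add]
  refine (measure_iUnion_fintype_le _ _).trans ?_
  have hb : ∀ o ∈ (Finset.univ : Finset (Option Cat)),
      P {x | x o ∈ {y : ℝ | κ o < |y - (shN c o : ℝ)|}} ≤ ENNReal.ofReal (1 / K ^ 2) := by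
    intro o _
    rw [hev o _ (measurableSet_lt (by fun_prop) (by fun_prop))]
    refine (gammaShape_cheb _ (hκpos o)).trans (ENNReal.ofReal_le_ofReal ?_)
    cases o with
    | none => simp [hκ, shN]
    | some i =>
      simp only [hκ, shN, Option.elim]
      rw [mul_pow, Real.sq_sqrt hn'.le, div_le_div_iff₀ (by positivity) (by positivity)]
      have : (c i : ℝ) ≤ n := by
        rw [← hc]
        exact_mod_cast Finset.single_le_sum (f := c) (fun i _ => Nat.zero_le _) (Finset.mem_univ i)
      have := mul_le_mul_of_nonneg_right this (sq_nonneg K)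
      linarith
  refine (Finset.sum_le_sum hb).trans ?_
  simp

lemma charFun_W (c0 c1 : Cat → ℕ) (b0 b1 : Option Cat → ℝ) (t : ℝ) :
    charFun (((Measure.pi fun o => gammaShape (shapeOf c0 o)).prod
      (Measure.pi fun o => gammaShape (shapeOf c1 o))).map
        (fun x => ∑ o, b0 o * (x.1 o - shN c0 o) + ∑ o, b1 o * (x.2 o - shN c1 o))) t =
    (∏ o, (Complex.exp (-(((t * b0 o : ℝ) : ℂ) * shN c0 o * Complex.I)) *
      ((1 - ((t * b0 o : ℝ) : ℂ) * Complex.I)⁻¹) ^ (shN c0 o))) *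
    (∏ o, (Complex.exp (-(((t * b1 o : ℝ) : ℂ) * shN c1 o * Complex.I)) *
      ((1 - ((t * b1 o : ℝ) : ℂ) * Complex.I)⁻¹) ^ (shN c1 o))) := by
  have one : ∀ (c : ℕ) (b : ℝ), ∫ y, Complex.exp (((b * (y - c) : ℝ) : ℂ) * Complex.I)
      ∂(gammaShape (c : ℝ)) =
      Complex.exp (-((b : ℂ) * c * Complex.I)) * ((1 - (b : ℂ) * Complex.I)⁻¹) ^ c := by
    intro c b
    rw [← charFun_gammaShape, charFun_apply_real, ← integral_const_mul]
    congr 1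
    ext y
    rw [← Complex.exp_add]
    congr 1
    push_cast
    ring
  have multi : ∀ (c : Cat → ℕ) (b : Option Cat → ℝ),
      ∫ x : Option Cat → ℝ, Complex.exp (((t * ∑ o, b o * (x o - shN c o) : ℝ) : ℂ) * Complex.I)
        ∂(Measure.pi fun o => gammaShape (shapeOf c o)) =
      ∏ o, (Complex.exp (-(((t * b o : ℝ) : ℂ) * shN c o * Complex.I)) *
      ((1 - ((t * b o : ℝ) : ℂ) * Complex.I)⁻¹) ^ (shN c o)) := by
    intro c b
    have h1 : ∀ x : Option Cat → ℝ,
        Complex.exp (((t * ∑ o, b o * (x o - shN c o) : ℝ) : ℂ) * Complex.I) =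
        ∏ o, Complex.exp ((((t * b o) * (x o - shN c o) : ℝ) : ℂ) * Complex.I) := by
      intro x
      rw [← Complex.exp_sum]
      congr 1
      rw [Finset.mul_sum]
      push_cast
      rw [Finset.sum_mul]
      refine Finset.sum_congr rfl fun o _ => ?_
      ring
    simp only [h1]
    rw [integral_fintype_prod_eq_prod (μ := fun o => gammaShape (shapeOf c o))
      (f := fun o y => Complex.exp ((((t * b o) * (y - shN c o) : ℝ) : ℂ) * Complex.I))]
    refine Finset.prod_congr rfl fun o _ => ?_
    rw [shapeOf_eq, one]
  rw [charFun_apply_real, integral_map (by fun_prop) (by fun_prop), ← multi, ← multi,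
    ← integral_prod_mul]
  congr 1
  ext x
  rw [← Complex.exp_add]
  congr 1
  push_cast
  ring

lemma bigO_one_sum {F : Cat → ℕ → ℝ} (h : ∀ i, (F i) =O[atTop] (fun _ => (1 : ℝ))) :
    (fun k => ∑ i, F i k) =O[atTop] (fun _ => (1 : ℝ)) := by
  have := IsBigO.sum (s := Finset.univ) fun i _ => h i
  refine this.congr_left fun k => ?_
  rw [Finset.sum_apply]

/-- Asymptotics of one Gamma vector on the good event. -/
lemma one_side (n : ℕ → ℕ) (hn : Tendsto n atTop atTop) (N : ℕ → ℝ) (κ : ℝ)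
    (hN : Tendsto (fun k => N k / n k) atTop (𝓝 κ)) (hN0 : ∀ k, 0 ≤ N k)
    (c : ℕ → Cat → ℕ) (hc : ∀ k, ∑ i, c k i = n k) (q : Cat → ℝ)
    (hq : ∀ i, Tendsto (fun k => (c k i : ℝ) / n k) atTop (𝓝 (q i)))
    (K : ℝ) (x : ℕ → Option Cat → ℝ) (hx : ∀ k, x k ∈ Good K (n k) (c k)) (d : Cat → ℝ) :
    (∀ i, (fun k => √(N k) * (x k (some i) / (∑ o, x k o) - c k i / n k)) =O[atTop]
      (fun _ => (1 : ℝ))) ∧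
    Tendsto (fun k => √(N k) * (x k none / ∑ o, x k o)) atTop (𝓝 0) ∧
    Tendsto (fun k => ∑ o, x k o) atTop atTop ∧
    Tendsto (fun k => ∑ i, d i * (√(N k) * (x k (some i) / (∑ o, x k o) - c k i / n k)) -
      ∑ i, (√(N k) / n k * (d i - ∑ j, d j * (c k j / n k))) * (x k (some i) - c k i))
      atTop (𝓝 0) := by
  have hnR : Tendsto (fun k => (n k : ℝ)) atTop atTop := tendsto_natCast_atTop_atTop.comp hn
  have hnpos : ∀ᶠ k in atTop, (0 : ℝ) < n k := hnR.eventually_gt_atTop 0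
  have hsq : Tendsto (fun k => √(n k : ℝ)) atTop atTop := Real.tendsto_sqrt_atTop.comp hnR
  have hsqi : (fun k => (√(n k : ℝ))⁻¹) =o[atTop] (fun _ => (1 : ℝ)) :=
    (isLittleO_one_iff ℝ).mpr (tendsto_inv_atTop_zero.comp hsq)
  set e : Cat → ℕ → ℝ := fun i k => (x k (some i) - c k i) / √(n k) with he
  have heO : ∀ i, (e i) =O[atTop] (fun _ => (1 : ℝ)) := by
    intro i
    refine IsBigO.of_bound K ?_
    filter_upwards [hnpos] with k hk
    rw [norm_one, mul_one, Real.norm_eq_abs, he, abs_div, abs_of_pos (Real.sqrt_pos.mpr hk),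
      div_le_iff₀ (Real.sqrt_pos.mpr hk)]
    exact (hx k).2.2 i
  have hx0 : (fun k => x k none) =O[atTop] (fun _ => (1 : ℝ)) := by
    refine IsBigO.of_bound (K + 1) (Eventually.of_forall fun k => ?_)
    rw [norm_one, mul_one, Real.norm_eq_abs]
    have := (hx k).2.1
    rw [abs_le] at this ⊢
    constructor <;> linarith
  have hseO : (fun k => ∑ i, e i k) =O[atTop] (fun _ => (1 : ℝ)) :=
    bigO_one_sum heO
  have hx0o : (fun k => x k none * (√(n k : ℝ))⁻¹) =o[atTop] (fun _ => (1 : ℝ)) := by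
    simpa using hx0.mul_isLittleO hsqi
  set ρ : ℕ → ℝ := fun k => √(N k) / √(n k) with hρ
  have hρO : ρ =O[atTop] (fun _ => (1 : ℝ)) := by
    have : Tendsto ρ atTop (𝓝 √κ) := by
      refine ((Real.continuous_sqrt.tendsto κ).comp hN).congr fun k => ?_
      simp only [Function.comp_apply, hρ]
      rw [Real.sqrt_div (hN0 k)]
    exact this.isBigO_one ℝ
  have hSexp : ∀ᶠ k in atTop, ∑ o, x k o =
      n k * (1 + ((∑ i, e i k) + x k none * (√(n k : ℝ))⁻¹) * (√(n k : ℝ))⁻¹) := by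
    filter_upwards [hnpos] with k hk
    have hs := Real.sqrt_pos.mpr hk
    have hss : √(n k : ℝ) * √(n k : ℝ) = n k := Real.mul_self_sqrt hk.le
    have h1 : ∑ i, e i k = ((∑ i, x k (some i)) - n k) / √(n k : ℝ) := by
      simp only [he]
      rw [← Finset.sum_div, Finset.sum_sub_distrib, ← hc k]
      push_cast
      rfl
    rw [Fintype.sum_option, h1]
    field_simp
    rw [Real.sq_sqrt hk.le]
    ring
  set a : ℕ → ℝ := fun k => 1 + ((∑ i, e i k) + x k none * (√(n k : ℝ))⁻¹) * (√(n k : ℝ))⁻¹ with ha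
  have ha1 : Tendsto a atTop (𝓝 1) := by
    have : (fun k => ((∑ i, e i k) + x k none * (√(n k : ℝ))⁻¹) * (√(n k : ℝ))⁻¹) =o[atTop]
        (fun _ => (1 : ℝ)) := by
      simpa using (hseO.add hx0o.isBigO).mul_isLittleO hsqi
    have h2 := ((isLittleO_one_iff ℝ).mp this).const_add 1
    simpa using h2
  have hai : Tendsto (fun k => (a k)⁻¹) atTop (𝓝 1) := by
    simpa using ha1.inv₀ one_ne_zero
  have haiO : (fun k => (a k)⁻¹) =O[atTop] (fun _ => (1 : ℝ)) := hai.isBigO_one ℝ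
  have hapos : ∀ᶠ k in atTop, 0 < a k := ha1.eventually (lt_mem_nhds one_pos)
  have hcO : ∀ i, (fun k => (c k i : ℝ) / n k) =O[atTop] (fun _ => (1 : ℝ)) :=
    fun i => (hq i).isBigO_one ℝ
  have hexp : ∀ i, ∀ᶠ k in atTop, √(N k) * (x k (some i) / (∑ o, x k o) - c k i / n k) =
      (a k)⁻¹ * ρ k * (e i k - c k i / n k * ((∑ j, e j k) + x k none * (√(n k : ℝ))⁻¹)) := by
    intro i
    filter_upwards [hnpos, hSexp, hapos] with k hk hS hak
    have hs := Real.sqrt_pos.mpr hk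
    rw [hS]
    change √(N k) * (x k (some i) / (n k * a k) - c k i / n k) = _
    have hae : ((∑ j, e j k) + x k none * (√(n k : ℝ))⁻¹) = (a k - 1) * √(n k : ℝ) := by
      simp only [ha]
      field_simp
      ring
    rw [hae]
    simp only [hρ, he]
    have hss : √(n k : ℝ) ^ 2 = n k := Real.sq_sqrt hk.le
    field_simp
    rw [hss]
    field_simp
    ring
  refine ⟨fun i => ?_, ?_, ?_, ?_⟩
  · have hb : (fun k => (a k)⁻¹ * ρ k *
        (e i k - c k i / n k * ((∑ j, e j k) + x k none * (√(n k : ℝ))⁻¹))) =O[atTop]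
        (fun _ => (1 : ℝ)) := by
      simpa using (haiO.mul hρO).mul
        ((heO i).sub (by simpa using (hcO i).mul (hseO.add hx0o.isBigO)))
    exact hb.congr' ((hexp i).mono fun k hk => hk.symm) EventuallyEq.rfl
  · have hb : (fun k => (a k)⁻¹ * ρ k * (x k none * (√(n k : ℝ))⁻¹)) =o[atTop]
        (fun _ => (1 : ℝ)) := by
      simpa using (haiO.mul hρO).mul_isLittleO hx0o
    refine ((isLittleO_one_iff ℝ).mp hb).congr' ?_
    filter_upwards [hnpos, hSexp, hapos] with k hk hS hak
    have hs := Real.sqrt_pos.mpr hk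
    rw [hS]
    change _ = √(N k) * (x k none / (n k * a k))
    have hss : √(n k : ℝ) ^ 2 = n k := Real.sq_sqrt hk.le
    simp only [hρ]
    field_simp
    rw [hss]
    ring
  · have := hnR.atTop_mul_pos one_pos ha1
    exact this.congr' (hSexp.mono fun k hk => hk.symm)
  · set m : ℕ → ℝ := fun k => ∑ j, d j * (c k j / n k) with hm
    have hmO : m =O[atTop] (fun _ => (1 : ℝ)) :=
      bigO_one_sum fun i => (hcO i).const_mul_left (d i)
    have hao : (fun k => (a k)⁻¹ - 1) =o[atTop] (fun _ => (1 : ℝ)) := by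
      rw [isLittleO_one_iff]
      simpa using hai.sub_const 1
    have hWO : (fun k => ∑ i, (d i - m k) * e i k) =O[atTop] (fun _ => (1 : ℝ)) :=
      bigO_one_sum fun i => by
        simpa using ((isBigO_const_const (d i) one_ne_zero atTop).sub hmO).mul (heO i)
    have hb : (fun k => ((a k)⁻¹ - 1) * (ρ k * ∑ i, (d i - m k) * e i k) -
        (a k)⁻¹ * ρ k * m k * (x k none * (√(n k : ℝ))⁻¹)) =o[atTop] (fun _ => (1 : ℝ)) := by
      refine IsLittleO.sub ?_ ?_
      · simpa using hao.mul_isBigO (hρO.mul hWO)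
      · simpa using ((haiO.mul hρO).mul hmO).mul_isLittleO hx0o
    refine ((isLittleO_one_iff ℝ).mp hb).congr' ?_
    have hexp' := eventually_all.mpr hexp
    filter_upwards [hnpos, hexp'] with k hk hek
    have hs := Real.sqrt_pos.mpr hk
    have hss : √(n k : ℝ) ^ 2 = n k := Real.sq_sqrt hk.le
    simp only [hek]
    have h1 : ∑ i, (√(N k) / n k * (d i - m k)) * (x k (some i) - c k i) =
        ρ k * ∑ i, (d i - m k) * e i k := by
      rw [Finset.mul_sum]
      refine Finset.sum_congr rfl fun i _ => ?_
      simp only [hρ, he]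
      field_simp
      rw [hss]
      ring
    have h2 : ∑ i, d i * ((a k)⁻¹ * ρ k *
        (e i k - c k i / n k * ((∑ j, e j k) + x k none * (√(n k : ℝ))⁻¹))) =
        (a k)⁻¹ * ρ k * (∑ i, d i * e i k -
          m k * ((∑ j, e j k) + x k none * (√(n k : ℝ))⁻¹)) := by
      rw [hm, Finset.sum_mul, ← Finset.sum_sub_distrib, Finset.mul_sum]
      refine Finset.sum_congr rfl fun i _ => ?_
      ring
    have h3 : ∑ i, (d i - m k) * e i k = ∑ i, d i * e i k - m k * ∑ i, e i k := by
      rw [Finset.mul_sum, ← Finset.sum_sub_distrib]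
      refine Finset.sum_congr rfl fun i _ => ?_
      ring
    rw [h1, h2, h3]
    ring


/-- Coefficients of the linearisation. -/
noncomputable def bvec (N : ℝ) (n : ℕ) (d : Cat → ℝ) (c : Cat → ℕ) : Option Cat → ℝ :=
  fun o => o.elim 0 (fun i => √N / n * (d i - ∑ j, d j * (c j / n)))

lemma side_char (n : ℕ → ℕ) (hn : Tendsto n atTop atTop) (N : ℕ → ℝ) (κ : ℝ)
    (hN : Tendsto (fun k => N k / n k) atTop (𝓝 κ)) (hN0 : ∀ k, 0 ≤ N k)
    (c : ℕ → Cat → ℕ) (q : Cat → ℝ)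
    (hq : ∀ i, Tendsto (fun k => (c k i : ℝ) / n k) atTop (𝓝 (q i)))
    (d : Cat → ℝ) (t : ℝ) :
    Tendsto (fun k => ∏ o, (Complex.exp (-(((t * bvec (N k) (n k) d (c k) o : ℝ) : ℂ) *
        shN (c k) o * Complex.I)) *
      ((1 - ((t * bvec (N k) (n k) d (c k) o : ℝ) : ℂ) * Complex.I)⁻¹) ^ (shN (c k) o))) atTop
      (𝓝 (Complex.exp (-(((t ^ 2 * (κ * ∑ i, q i * (d i - ∑ j, d j * q j) ^ 2) : ℝ) : ℂ) / 2)))) := by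
  have hnR : Tendsto (fun k => (n k : ℝ)) atTop atTop := tendsto_natCast_atTop_atTop.comp hn
  have hsq : Tendsto (fun k => √(n k : ℝ)) atTop atTop := Real.tendsto_sqrt_atTop.comp hnR
  have hm : Tendsto (fun k => ∑ j, d j * ((c k j : ℝ) / n k)) atTop (𝓝 (∑ j, d j * q j)) :=
    tendsto_finsetSum _ fun j _ => (hq j).const_mul (d j)
  have hr : Tendsto (fun k => √(N k) / n k) atTop (𝓝 0) := by
    have h1 : Tendsto (fun k => √(N k / n k) * (√(n k : ℝ))⁻¹) atTop (𝓝 (√κ * 0)) :=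
      ((Real.continuous_sqrt.tendsto κ).comp hN).mul (tendsto_inv_atTop_zero.comp hsq)
    rw [mul_zero] at h1
    refine h1.congr fun k => ?_
    rw [Real.sqrt_div (hN0 k), div_eq_mul_inv, mul_assoc, ← mul_inv,
      Real.mul_self_sqrt (Nat.cast_nonneg _), div_eq_mul_inv]
  have hfac : ∀ i : Cat, Tendsto (fun k =>
      (Complex.exp (-(((t * bvec (N k) (n k) d (c k) (some i) : ℝ) : ℂ) *
        (c k i : ℕ) * Complex.I)) *
      ((1 - ((t * bvec (N k) (n k) d (c k) (some i) : ℝ) : ℂ) * Complex.I)⁻¹) ^ (c k i))) atTop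
      (𝓝 (Complex.exp (-(((t ^ 2 * (κ * (q i * (d i - ∑ j, d j * q j) ^ 2)) : ℝ) : ℂ) / 2)))) := by
    intro i
    refine gamma_char_limit (fun k => c k i) (fun k => t * bvec (N k) (n k) d (c k) (some i)) _ ?_ ?_
    · have := (hr.mul ((tendsto_const_nhds (x := d i)).sub hm)).const_mul t
      simpa [bvec] using this
    · have := (hN.mul ((hq i).mul (((tendsto_const_nhds (x := d i)).sub hm).pow 2))).const_mul (t ^ 2)
      refine this.congr fun k => ?_
      simp only [bvec, Option.elim]
      have hs := Real.sq_sqrt (hN0 k)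
      generalize (d i - ∑ j, d j * ((c k j : ℝ) / n k)) = E
      rw [mul_pow, mul_pow, div_pow, hs]
      simp only [div_eq_mul_inv]
      ring
  have hprod := tendsto_finsetProd Finset.univ fun i _ => hfac i
  have hlim : ∏ i : Cat, Complex.exp (-(((t ^ 2 * (κ * (q i * (d i - ∑ j, d j * q j) ^ 2)) : ℝ) : ℂ) / 2))
      = Complex.exp (-(((t ^ 2 * (κ * ∑ i, q i * (d i - ∑ j, d j * q j) ^ 2) : ℝ) : ℂ) / 2)) := by
    rw [← Complex.exp_sum]
    congr 1
    rw [Finset.sum_neg_distrib, ← Finset.sum_div, ← Complex.ofReal_sum, Finset.mul_sum,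
      Finset.mul_sum]
  rw [hlim] at hprod
  refine hprod.congr fun k => ?_
  rw [Fintype.prod_option]
  simp [bvec, shN]

/-- The linearised statistic. -/
noncomputable def Wfun (c0 c1 : Cat → ℕ) (b0 b1 : Option Cat → ℝ)
    (x : (Option Cat → ℝ) × (Option Cat → ℝ)) : ℝ :=
  ∑ o, b0 o * (x.1 o - shN c0 o) + ∑ o, b1 o * (x.2 o - shN c1 o)

lemma measurable_Wfun (c0 c1 : Cat → ℕ) (b0 b1 : Option Cat → ℝ) :
    Measurable (Wfun c0 c1 b0 b1) := by
  unfold Wfun; fun_prop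

/-- Product law of the two Gamma vectors. -/
noncomputable def GamLaw (c0 c1 : Cat → ℕ) : Measure ((Option Cat → ℝ) × (Option Cat → ℝ)) :=
  (Measure.pi fun o => gammaShape (shapeOf c0 o)).prod
      (Measure.pi fun o => gammaShape (shapeOf c1 o))

instance (c0 c1 : Cat → ℕ) : IsProbabilityMeasure (GamLaw c0 c1) := by
  unfold GamLaw; infer_instance

lemma var_eq {q d : Cat → ℝ} (hq : q ∈ stdSimplex ℝ Cat) :
    ∑ i, q i * (d i - ∑ j, d j * q j) ^ 2 = (∑ i, d i ^ 2 * q i) - (∑ i, d i * q i) ^ 2 := by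
  set m := ∑ j, d j * q j with hm
  have : ∀ i, q i * (d i - m) ^ 2 = d i ^ 2 * q i - 2 * m * (d i * q i) + m ^ 2 * q i := by
    intro i; ring
  simp only [this]
  rw [Finset.sum_add_distrib, Finset.sum_sub_distrib, ← Finset.mul_sum, ← Finset.mul_sum, hq.2, ← hm]
  ring

lemma var_nonneg {q d : Cat → ℝ} (hq : q ∈ stdSimplex ℝ Cat) :
    0 ≤ ∑ i, q i * (d i - ∑ j, d j * q j) ^ 2 :=
  Finset.sum_nonneg fun i _ => mul_nonneg (hq.1 i) (sq_nonneg _)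

lemma LP_W (n0 n1 : ℕ → ℕ) (hn0 : Tendsto n0 atTop atTop) (hn1 : Tendsto n1 atTop atTop)
    (N : ℕ → ℝ) (κ0 κ1 : ℝ) (hκ0 : 0 ≤ κ0) (hκ1 : 0 ≤ κ1)
    (hN0 : Tendsto (fun k => N k / n0 k) atTop (𝓝 κ0))
    (hN1 : Tendsto (fun k => N k / n1 k) atTop (𝓝 κ1)) (hN : ∀ k, 0 ≤ N k)
    (c0 c1 : ℕ → Cat → ℕ) (q0 q1 : Cat → ℝ) (hqs0 : q0 ∈ stdSimplex ℝ Cat)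
    (hqs1 : q1 ∈ stdSimplex ℝ Cat)
    (hq0 : ∀ i, Tendsto (fun k => (c0 k i : ℝ) / n0 k) atTop (𝓝 (q0 i)))
    (hq1 : ∀ i, Tendsto (fun k => (c1 k i : ℝ) / n1 k) atTop (𝓝 (q1 i)))
    (d0 d1 : Cat → ℝ) (s : ℝ) (hs : s = κ0 * ∑ i, q0 i * (d0 i - ∑ j, d0 j * q0 j) ^ 2 +
      κ1 * ∑ i, q1 i * (d1 i - ∑ j, d1 j * q1 j) ^ 2) :
    Tendsto (fun k => levyProkhorovEDist ((GamLaw (c0 k) (c1 k)).map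
      (Wfun (c0 k) (c1 k) (bvec (N k) (n0 k) d0 (c0 k)) (bvec (N k) (n1 k) d1 (c1 k))))
      (gaussianReal 0 s.toNNReal)) atTop (𝓝 0) := by
  have hpr : ∀ k, IsProbabilityMeasure ((GamLaw (c0 k) (c1 k)).map
      (Wfun (c0 k) (c1 k) (bvec (N k) (n0 k) d0 (c0 k)) (bvec (N k) (n1 k) d1 (c1 k)))) :=
    fun k => Measure.isProbabilityMeasure_map (measurable_Wfun _ _ _ _).aemeasurable
  refine LP_tendsto _ _ fun t => ?_
  have hs0 : 0 ≤ s := by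
    rw [hs]; exact add_nonneg (mul_nonneg hκ0 (var_nonneg hqs0)) (mul_nonneg hκ1 (var_nonneg hqs1))
  have h := (side_char n0 hn0 N κ0 hN0 hN c0 q0 hq0 d0 t).mul
    (side_char n1 hn1 N κ1 hN1 hN c1 q1 hq1 d1 t)
  rw [← Complex.exp_add] at h
  rw [charFun_gaussianReal]
  convert h using 1
  · ext k
    exact charFun_W _ _ _ _ t
  · congr 2
    rw [Real.coe_toNNReal _ hs0, hs]
    push_cast
    ring


lemma clm_expand (G' : ((Cat → ℝ) × (Cat → ℝ)) →L[ℝ] ℝ) (u : (Cat → ℝ) × (Cat → ℝ)) :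
    G' u = ∑ i, G' ((Pi.single i 1 : Cat → ℝ), 0) * u.1 i +
      ∑ i, G' (0, (Pi.single i 1 : Cat → ℝ)) * u.2 i := by
  have h0 : ∀ w : Cat → ℝ, w = ∑ i, w i • (Pi.single i 1 : Cat → ℝ) := by
    intro w
    ext j
    simp [Finset.sum_apply, Pi.single_apply]
  have h1 : u = ∑ i, u.1 i • ((Pi.single i 1 : Cat → ℝ), (0 : Cat → ℝ)) +
      ∑ i, u.2 i • ((0 : Cat → ℝ), (Pi.single i 1 : Cat → ℝ)) := by
    refine Prod.ext ?_ ?_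
    · rw [Prod.fst_add, Prod.fst_sum, Prod.fst_sum]
      simpa using h0 u.1
    · rw [Prod.snd_add, Prod.snd_sum, Prod.snd_sum]
      simpa using h0 u.2
  conv_lhs => rw [h1]
  rw [map_add, map_sum, map_sum]
  simp only [map_smul, smul_eq_mul]
  congr 1 <;> exact Finset.sum_congr rfl fun i _ => mul_comm _ _

/-- Normalised table. -/
noncomputable def nrm (x : Option Cat → ℝ) : Cat → ℝ := fun i => x (some i) / ∑ o, x o

/-- The centered and scaled fiducial optimum as a function of the Gamma vectors. -/
noncomputable def Yfun (f : PTab → ℝ) (N : ℝ) (w : (Cat → ℝ) × (Cat → ℝ))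
    (x : (Option Cat → ℝ) × (Option Cat → ℝ)) : ℝ :=
  √N * (GstarVal f (nrm x.1) (nrm x.2) - gval f w)

lemma measurable_Yfun {f : PTab → ℝ} (hf : Continuous f) (N : ℝ) (w : (Cat → ℝ) × (Cat → ℝ)) :
    Measurable (Yfun f N w) := by
  have h : Measurable fun x : (Option Cat → ℝ) × (Option Cat → ℝ) => (nrm x.1, nrm x.2) := by
    unfold nrm; fun_prop
  exact (((measurable_GstarVal hf).comp h).sub_const _).const_mul _

lemma law_eq {f : PTab → ℝ} (hf : Continuous f) (N : ℝ) (w : (Cat → ℝ) × (Cat → ℝ))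
    (c0 c1 : Cat → ℕ) :
    Measure.map (fun vv : (Option Cat → ℝ) × (Option Cat → ℝ) =>
      √N * (GstarVal f (fun ay => vv.1 (some ay)) (fun ay => vv.2 (some ay)) - gval f w))
      ((dirichlet (shapeOf c0)).prod (dirichlet (shapeOf c1))) =
    (GamLaw c0 c1).map (Yfun f N w) := by
  have hnm : Measurable fun (x : Option Cat → ℝ) (i : Option Cat) => x i / ∑ j, x j := by fun_prop
  have hp : Measurable fun x : (Option Cat → ℝ) × (Option Cat → ℝ) =>
    ((fun ay : Cat => x.1 (some ay)), (fun ay : Cat => x.2 (some ay))) := by fun_prop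
  unfold dirichlet
  rw [Measure.map_prod_map _ _ hnm hnm, Measure.map_map _ (by fun_prop)]
  · rfl
  · exact (((measurable_GstarVal hf).comp hp).sub_const _).const_mul _

lemma norm_le_sum (u : (Cat → ℝ) × (Cat → ℝ)) : ‖u‖ ≤ ∑ i, |u.1 i| + ∑ i, |u.2 i| := by
  have h : ∀ w : Cat → ℝ, ‖w‖ ≤ ∑ i, |w i| := by
    intro w
    refine (pi_norm_le_iff_of_nonneg (Finset.sum_nonneg fun i _ => abs_nonneg _)).mpr fun i => ?_
    exact Finset.single_le_sum (f := fun i => |w i|) (fun i _ => abs_nonneg _) (Finset.mem_univ i)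
  have h1 : ∀ w : Cat → ℝ, 0 ≤ ∑ i, |w i| := fun w => Finset.sum_nonneg fun i _ => abs_nonneg _
  rw [Prod.norm_def]
  exact max_le ((h u.1).trans (by linarith [h1 u.2])) ((h u.2).trans (by linarith [h1 u.1]))

lemma strict_ball {G : (Cat → ℝ) × (Cat → ℝ) → ℝ} {U : Set ((Cat → ℝ) × (Cat → ℝ))}
    (hU : IsOpen U) {q : (Cat → ℝ) × (Cat → ℝ)} (hq : q ∈ U) (hG : ContDiffOn ℝ 1 G U)
    {η : ℝ} (hη : 0 < η) : ∃ δ > 0, Metric.ball q δ ⊆ U ∧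
      ∀ x ∈ Metric.ball q δ, ∀ y ∈ Metric.ball q δ,
      |G x - G y - fderiv ℝ G q (x - y)| ≤ η * ‖x - y‖ := by
  have h1 := (hG.contDiffAt (hU.mem_nhds hq)).hasStrictFDerivAt one_ne_zero
  have h2 := h1.isLittleO.def hη
  obtain ⟨δ1, hδ1, hb⟩ := Metric.eventually_nhds_iff_ball.mp h2
  obtain ⟨δ2, hδ2, hb2⟩ := Metric.isOpen_iff.mp hU q hq
  refine ⟨min δ1 δ2, lt_min hδ1 hδ2, (Metric.ball_subset_ball (min_le_right _ _)).trans hb2, ?_⟩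
  intro x hx y hy
  refine hb (x, y) ?_
  rw [← ball_prod_same]
  exact ⟨Metric.ball_subset_ball (min_le_left _ _) hx, Metric.ball_subset_ball (min_le_left _ _) hy⟩

lemma nrm_props {x : Option Cat → ℝ} (hx : ∀ o, 0 ≤ x o) (hS : 0 < ∑ o, x o) :
    0 ≤ x none / ∑ o, x o ∧ 0 ≤ nrm x ∧ ∑ i, nrm x i = 1 - x none / ∑ o, x o := by
  refine ⟨div_nonneg (hx _) hS.le, fun i => div_nonneg (hx _) hS.le, ?_⟩
  unfold nrm
  rw [← Finset.sum_div, eq_sub_iff_add_eq, ← add_div, add_comm, ← Fintype.sum_option]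
  exact div_self hS.ne'

lemma Y_sub_W {f : PTab → ℝ} (hf : Continuous f)
    {G : (Cat → ℝ) × (Cat → ℝ) → ℝ} {U : Set ((Cat → ℝ) × (Cat → ℝ))}
    (hU : IsOpen U)
    (hUF : U ∩ (stdSimplex ℝ Cat ×ˢ stdSimplex ℝ Cat) ⊆ Feas)
    (hGg : ∀ qq ∈ U ∩ (stdSimplex ℝ Cat ×ˢ stdSimplex ℝ Cat), G qq = gval f qq)
    (hG : ContDiffOn ℝ 1 G U) (q0 q1 : Cat → ℝ) (hqU : (q0, q1) ∈ U)
    (n0 n1 : ℕ → ℕ) (hn0 : Tendsto n0 atTop atTop) (hn1 : Tendsto n1 atTop atTop)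
    (N : ℕ → ℝ) (κ0 κ1 : ℝ) (hNtop : Tendsto N atTop atTop)
    (hN0 : Tendsto (fun k => N k / n0 k) atTop (𝓝 κ0))
    (hN1 : Tendsto (fun k => N k / n1 k) atTop (𝓝 κ1)) (hN : ∀ k, 0 ≤ N k)
    (c0 c1 : ℕ → Cat → ℕ) (hc0 : ∀ k, ∑ i, c0 k i = n0 k) (hc1 : ∀ k, ∑ i, c1 k i = n1 k)
    (hq0 : ∀ i, Tendsto (fun k => (c0 k i : ℝ) / n0 k) atTop (𝓝 (q0 i)))
    (hq1 : ∀ i, Tendsto (fun k => (c1 k i : ℝ) / n1 k) atTop (𝓝 (q1 i)))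
    (d0 d1 : Cat → ℝ)
    (hd0 : ∀ i, d0 i = fderiv ℝ G (q0, q1) ((Pi.single i 1 : Cat → ℝ), 0))
    (hd1 : ∀ i, d1 i = fderiv ℝ G (q0, q1) (0, (Pi.single i 1 : Cat → ℝ)))
    (K : ℝ) (x : ℕ → (Option Cat → ℝ) × (Option Cat → ℝ))
    (hx : ∀ k, x k ∈ Good K (n0 k) (c0 k) ×ˢ Good K (n1 k) (c1 k)) :
    Tendsto (fun k => Yfun f (N k) (fun i => (c0 k i : ℝ) / n0 k, fun i => (c1 k i : ℝ) / n1 k) (x k) -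
      Wfun (c0 k) (c1 k) (bvec (N k) (n0 k) d0 (c0 k)) (bvec (N k) (n1 k) d1 (c1 k)) (x k))
      atTop (𝓝 0) := by
  obtain ⟨a1, a2, a3, a4⟩ := one_side n0 hn0 N κ0 hN0 hN c0 hc0 q0 hq0 K (fun k => (x k).1)
    (fun k => (hx k).1) d0
  obtain ⟨e1, e2, e3, e4⟩ := one_side n1 hn1 N κ1 hN1 hN c1 hc1 q1 hq1 K (fun k => (x k).2)
    (fun k => (hx k).2) d1
  set w : ℕ → (Cat → ℝ) × (Cat → ℝ) :=
    fun k => (fun i => (c0 k i : ℝ) / n0 k, fun i => (c1 k i : ℝ) / n1 k) with hw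
  set v : ℕ → (Cat → ℝ) × (Cat → ℝ) := fun k => (nrm (x k).1, nrm (x k).2) with hv
  set r0 : ℕ → ℝ := fun k => (x k).1 none / ∑ o, (x k).1 o with hr0
  set r1 : ℕ → ℝ := fun k => (x k).2 none / ∑ o, (x k).2 o with hr1
  set G' := fderiv ℝ G (q0, q1) with hG'
  have hsN : Tendsto (fun k => √(N k)) atTop atTop := Real.tendsto_sqrt_atTop.comp hNtop
  have hsNi : Tendsto (fun k => (√(N k))⁻¹) atTop (𝓝 0) := tendsto_inv_atTop_zero.comp hsN
  have hR : Tendsto (fun k => √(N k) * (r0 k + r1 k)) atTop (𝓝 0) := by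
    have := a2.add e2
    rw [add_zero] at this
    exact this.congr fun k => by simp only [hr0, hr1]; ring
  have hA : (fun k => √(N k) * ‖v k - w k‖) =O[atTop] (fun _ => (1 : ℝ)) := by
    have h1 : (fun k => ∑ i, |√(N k) * (nrm (x k).1 i - (c0 k i : ℝ) / n0 k)| +
        ∑ i, |√(N k) * (nrm (x k).2 i - (c1 k i : ℝ) / n1 k)|) =O[atTop] (fun _ => (1 : ℝ)) :=
      (bigO_one_sum fun i => (a1 i).abs_left).add (bigO_one_sum fun i => (e1 i).abs_left)
    refine IsBigO.trans (IsBigO.of_bound 1 (Eventually.of_forall fun k => ?_)) h1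
    rw [one_mul, Real.norm_eq_abs, Real.norm_eq_abs, abs_of_nonneg (by positivity)]
    refine le_trans ?_ (le_abs_self _)
    simp only [abs_mul, abs_of_nonneg (Real.sqrt_nonneg _)]
    rw [← Finset.mul_sum, ← Finset.mul_sum, ← mul_add]
    exact mul_le_mul_of_nonneg_left (norm_le_sum _) (Real.sqrt_nonneg _)
  have hvw : Tendsto (fun k => ‖v k - w k‖) atTop (𝓝 0) := by
    have h1 := (isLittleO_one_iff ℝ).mp (by simpa using hA.mul_isLittleO ((isLittleO_one_iff ℝ).mpr hsNi) :
      (fun k => √(N k) * ‖v k - w k‖ * (√(N k))⁻¹) =o[atTop] (fun _ => (1 : ℝ)))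
    refine h1.congr' ?_
    filter_upwards [hsN.eventually_gt_atTop 0] with k hk
    field_simp
  have hrr : Tendsto (fun k => r0 k + r1 k) atTop (𝓝 0) := by
    have h1 := hR.mul hsNi
    rw [mul_zero] at h1
    refine h1.congr' ?_
    filter_upwards [hsN.eventually_gt_atTop 0] with k hk
    field_simp
  have hwq : Tendsto w atTop (𝓝 (q0, q1)) :=
    (tendsto_pi_nhds.mpr hq0).prodMk_nhds (tendsto_pi_nhds.mpr hq1)
  have hwq' : Tendsto (fun k => ‖w k - (q0, q1)‖) atTop (𝓝 0) :=
    tendsto_iff_norm_sub_tendsto_zero.mp hwq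
  have hws : ∀ᶠ k in atTop, (w k).1 ∈ stdSimplex ℝ Cat ∧ (w k).2 ∈ stdSimplex ℝ Cat := by
    filter_upwards [hn0.eventually_gt_atTop 0, hn1.eventually_gt_atTop 0] with k h0 h1
    have h0' : (n0 k : ℝ) ≠ 0 := by exact_mod_cast h0.ne'
    have h1' : (n1 k : ℝ) ≠ 0 := by exact_mod_cast h1.ne'
    refine ⟨⟨fun i => by positivity, ?_⟩, ⟨fun i => by positivity, ?_⟩⟩
    · change ∑ i, (c0 k i : ℝ) / n0 k = 1
      rw [← Finset.sum_div, ← Nat.cast_sum, hc0]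
      exact div_self h0'
    · change ∑ i, (c1 k i : ℝ) / n1 k = 1
      rw [← Finset.sum_div, ← Nat.cast_sum, hc1]
      exact div_self h1'
  obtain ⟨M, hMpos, hM⟩ := hA.exists_pos
  have hZ : Tendsto (fun k => √(N k) * (GstarVal f (v k).1 (v k).2 - gval f (w k) - G' (v k - w k)))
      atTop (𝓝 0) := by
    rw [Metric.tendsto_nhds]
    intro ε hε
    set η := ε / (2 * (M + 1)) with hη
    have hηpos : 0 < η := by positivity
    obtain ⟨δ, hδ, hball, hlin⟩ := strict_ball hU hqU hG hηpos
    have hlim : Tendsto (fun k => ‖v k - w k‖ + ‖w k - (q0, q1)‖ + (r0 k + r1 k)) atTop (𝓝 0) := by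
      simpa using (hvw.add hwq').add hrr
    have hlim2 : Tendsto (fun k => η * (√(N k) * (r0 k + r1 k)) + ‖G'‖ * (√(N k) * (r0 k + r1 k)))
        atTop (𝓝 0) := by
      simpa using (hR.const_mul η).add (hR.const_mul ‖G'‖)
    filter_upwards [hlim.eventually (gt_mem_nhds hδ), hlim2.eventually (gt_mem_nhds (half_pos hε)),
      hws, hM.bound, a3.eventually_gt_atTop 0, e3.eventually_gt_atTop 0,
      hwq.eventually (Metric.ball_mem_nhds _ hδ)] with k k1 k2 k3 k4 k5 k6 k7
    obtain ⟨p0, p1, p2⟩ := nrm_props (hx k).1.1 k5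
    obtain ⟨s0, s1, s2⟩ := nrm_props (hx k).2.1 k6
    have hb := Gstar_bound hf hUF hGg hηpos.le hball hlin (v := v k) (w := w k) p0 s0 p1 s1 p2 s2
      (by
        have : ‖v k - (q0, q1)‖ ≤ ‖v k - w k‖ + ‖w k - (q0, q1)‖ := norm_sub_le_norm_sub_add_norm_sub _ _ _
        simp only [hr0, hr1] at k1
        linarith) k3.1 k3.2 k7
    rw [Real.dist_eq, sub_zero, abs_mul, abs_of_nonneg (Real.sqrt_nonneg _)]
    have hb2 := mul_le_mul_of_nonneg_left hb (Real.sqrt_nonneg (N k))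
    rw [norm_one, mul_one, Real.norm_eq_abs, abs_of_nonneg (by positivity)] at k4
    have hηM : η * (√(N k) * ‖v k - w k‖) ≤ ε / 2 := by
      calc η * (√(N k) * ‖v k - w k‖) ≤ η * (M + 1) := by gcongr; linarith
        _ = ε / 2 := by rw [hη]; field_simp
    change _ ≤ √(N k) * (η * (‖v k - w k‖ + (r0 k + r1 k)) + ‖G'‖ * (r0 k + r1 k)) at hb2
    nlinarith
  have hfin := hZ.add (a4.add e4)
  simp only [add_zero] at hfin
  refine hfin.congr fun k => ?_
  rw [clm_expand G' (v k - w k)]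
  simp only [← hd0, ← hd1]
  have hWe : Wfun (c0 k) (c1 k) (bvec (N k) (n0 k) d0 (c0 k)) (bvec (N k) (n1 k) d1 (c1 k)) (x k) =
      ∑ i, (√(N k) / n0 k * (d0 i - ∑ j, d0 j * (c0 k j / n0 k))) * ((x k).1 (some i) - c0 k i) +
      ∑ i, (√(N k) / n1 k * (d1 i - ∑ j, d1 j * (c1 k j / n1 k))) * ((x k).2 (some i) - c1 k i) := by
    unfold Wfun
    rw [Fintype.sum_option, Fintype.sum_option]
    simp only [bvec, shN, Option.elim, zero_mul, zero_add]
  rw [hWe]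
  unfold Yfun
  have t0 : ∑ i, d0 i * (√(N k) * ((x k).1 (some i) / (∑ o, (x k).1 o) - c0 k i / n0 k)) =
      √(N k) * ∑ i, d0 i * (v k - w k).1 i := by
    rw [Finset.mul_sum]
    refine Finset.sum_congr rfl fun i _ => ?_
    simp only [hv, hw, Prod.fst_sub, Pi.sub_apply, nrm]
    ring
  have t1 : ∑ i, d1 i * (√(N k) * ((x k).2 (some i) / (∑ o, (x k).2 o) - c1 k i / n1 k)) =
      √(N k) * ∑ i, d1 i * (v k - w k).2 i := by
    rw [Finset.mul_sum]
    refine Finset.sum_congr rfl fun i _ => ?_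
    simp only [hv, hw, Prod.snd_sub, Pi.sub_apply, nrm]
    ring
  rw [t0, t1]
  simp only [hv]
  ring


lemma center_mem {K : ℝ} (hK : 0 ≤ K) (n : ℕ) (c : Cat → ℕ) :
    (fun o => (shN c o : ℝ)) ∈ Good K n c := by
  refine ⟨fun o => Nat.cast_nonneg _, ?_, fun i => ?_⟩
  · simpa [shN] using hK
  · simp only [shN, Option.elim, sub_self, abs_zero]
    positivity

lemma seq_claim {f : PTab → ℝ} (hf : Continuous f)
    {G : (Cat → ℝ) × (Cat → ℝ) → ℝ} {U : Set ((Cat → ℝ) × (Cat → ℝ))}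
    (hU : IsOpen U)
    (hUF : U ∩ (stdSimplex ℝ Cat ×ˢ stdSimplex ℝ Cat) ⊆ Feas)
    (hGg : ∀ qq ∈ U ∩ (stdSimplex ℝ Cat ×ˢ stdSimplex ℝ Cat), G qq = gval f qq)
    (hG : ContDiffOn ℝ 1 G U) (q0 q1 : Cat → ℝ) (hqU : (q0, q1) ∈ U)
    (hqs0 : q0 ∈ stdSimplex ℝ Cat) (hqs1 : q1 ∈ stdSimplex ℝ Cat)
    (n0 n1 : ℕ → ℕ) (hn0 : Tendsto n0 atTop atTop) (hn1 : Tendsto n1 atTop atTop)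
    (N : ℕ → ℝ) (κ0 κ1 : ℝ) (hκ0 : 0 ≤ κ0) (hκ1 : 0 ≤ κ1) (hNtop : Tendsto N atTop atTop)
    (hN0 : Tendsto (fun k => N k / n0 k) atTop (𝓝 κ0))
    (hN1 : Tendsto (fun k => N k / n1 k) atTop (𝓝 κ1)) (hN : ∀ k, 0 ≤ N k)
    (c0 c1 : ℕ → Cat → ℕ) (hc0 : ∀ k, ∑ i, c0 k i = n0 k) (hc1 : ∀ k, ∑ i, c1 k i = n1 k)
    (hq0 : ∀ i, Tendsto (fun k => (c0 k i : ℝ) / n0 k) atTop (𝓝 (q0 i)))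
    (hq1 : ∀ i, Tendsto (fun k => (c1 k i : ℝ) / n1 k) atTop (𝓝 (q1 i)))
    (d0 d1 : Cat → ℝ)
    (hd0 : ∀ i, d0 i = fderiv ℝ G (q0, q1) ((Pi.single i 1 : Cat → ℝ), 0))
    (hd1 : ∀ i, d1 i = fderiv ℝ G (q0, q1) (0, (Pi.single i 1 : Cat → ℝ)))
    (s : ℝ) (hs : s = κ0 * ∑ i, q0 i * (d0 i - ∑ j, d0 j * q0 j) ^ 2 +
      κ1 * ∑ i, q1 i * (d1 i - ∑ j, d1 j * q1 j) ^ 2) :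
    Tendsto (fun k => levyProkhorovEDist ((GamLaw (c0 k) (c1 k)).map
      (Yfun f (N k) (fun i => (c0 k i : ℝ) / n0 k, fun i => (c1 k i : ℝ) / n1 k)))
      (gaussianReal 0 s.toNNReal)) atTop (𝓝 0) := by
  set Y : ℕ → (Option Cat → ℝ) × (Option Cat → ℝ) → ℝ := fun k =>
    Yfun f (N k) (fun i => (c0 k i : ℝ) / n0 k, fun i => (c1 k i : ℝ) / n1 k) with hY
  set W : ℕ → (Option Cat → ℝ) × (Option Cat → ℝ) → ℝ := fun k =>
    Wfun (c0 k) (c1 k) (bvec (N k) (n0 k) d0 (c0 k)) (bvec (N k) (n1 k) d1 (c1 k)) with hW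
  have hYm : ∀ k, Measurable (Y k) := fun k => measurable_Yfun hf _ _
  have hWm : ∀ k, Measurable (W k) := fun k => measurable_Wfun _ _ _ _
  have hLW := LP_W n0 n1 hn0 hn1 N κ0 κ1 hκ0 hκ1 hN0 hN1 hN c0 c1 q0 q1 hqs0 hqs1 hq0 hq1 d0 d1 s hs
  rw [ENNReal.tendsto_nhds_zero] at hLW ⊢
  intro ε hε
  have hε2 : 0 < ε / 2 := ENNReal.half_pos hε.ne'
  obtain ⟨e, he0, heε⟩ := ENNReal.lt_iff_exists_nnreal_btwn.mp hε2
  have he : (0 : ℝ) < e := by exact_mod_cast he0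
  set K : ℝ := √(10 / e) with hK
  have hKpos : 0 < K := Real.sqrt_pos.mpr (by positivity)
  have hK2 : K ^ 2 = 10 / e := Real.sq_sqrt (by positivity)
  have hunif : ∀ᶠ k in atTop, ∀ x ∈ Good K (n0 k) (c0 k) ×ˢ Good K (n1 k) (c1 k),
      |Y k x - W k x| ≤ e := by
    classical
    have hex : ∀ k, ∃ x ∈ Good K (n0 k) (c0 k) ×ˢ Good K (n1 k) (c1 k),
        (|Y k x - W k x| ≤ e → ∀ x' ∈ Good K (n0 k) (c0 k) ×ˢ Good K (n1 k) (c1 k),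
          |Y k x' - W k x'| ≤ e) := by
      intro k
      by_cases h : ∀ x' ∈ Good K (n0 k) (c0 k) ×ˢ Good K (n1 k) (c1 k), |Y k x' - W k x'| ≤ e
      · exact ⟨(fun o => (shN (c0 k) o : ℝ), fun o => (shN (c1 k) o : ℝ)), ⟨center_mem hKpos.le (n0 k) (c0 k), center_mem hKpos.le (n1 k) (c1 k)⟩, fun _ => h⟩
      · push Not at h
        obtain ⟨x, hx, hlt⟩ := h
        exact ⟨x, hx, fun hle => absurd hle (not_le.mpr hlt)⟩
    choose x hx hxx using hex
    have hlim := Y_sub_W hf hU hUF hGg hG q0 q1 hqU n0 n1 hn0 hn1 N κ0 κ1 hNtop hN0 hN1 hN c0 c1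
      hc0 hc1 hq0 hq1 d0 d1 hd0 hd1 K x hx
    rw [Metric.tendsto_nhds] at hlim
    filter_upwards [hlim e he] with k hk
    rw [Real.dist_eq, sub_zero] at hk
    exact hxx k hk.le
  filter_upwards [hLW (ε / 2) hε2, hunif, hn0.eventually_gt_atTop 0, hn1.eventually_gt_atTop 0]
    with k k1 k2 k3 k4
  have hbad : (GamLaw (c0 k) (c1 k)) {x | (e : ℝ) < |Y k x - W k x|} ≤ ENNReal.ofReal e := by
    have hsub : {x | (e : ℝ) < |Y k x - W k x|} ⊆
        (Good K (n0 k) (c0 k))ᶜ ×ˢ Set.univ ∪ Set.univ ×ˢ (Good K (n1 k) (c1 k))ᶜ := by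
      intro x hx
      by_contra hcon
      simp only [Set.mem_union, Set.mem_prod, Set.mem_compl_iff, Set.mem_univ, and_true, true_and,
        not_or, not_not] at hcon
      exact absurd (k2 x ⟨hcon.1, hcon.2⟩) (not_le.mpr hx)
    refine (measure_mono hsub).trans ((measure_union_le _ _).trans ?_)
    unfold GamLaw
    rw [Measure.prod_prod, Measure.prod_prod, measure_univ, measure_univ, one_mul, mul_one]
    refine (add_le_add (good_prob hKpos k3 (c0 k) (hc0 k)) (good_prob hKpos k4 (c1 k) (hc1 k))).trans ?_
    rw [← add_mul, hK2]
    norm_num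
    rw [show (10 : ℝ≥0∞) = ENNReal.ofReal 10 by simp, ← ENNReal.ofReal_coe_nnreal,
      ← ENNReal.ofReal_mul (by norm_num)]
    refine ENNReal.ofReal_le_ofReal (le_of_eq ?_)
    field_simp
  have h1 := LP_le (GamLaw (c0 k) (c1 k)) (hYm k) (hWm k) he.le hbad
  have := Measure.isProbabilityMeasure_map (μ := GamLaw (c0 k) (c1 k)) (hYm k).aemeasurable
  have := Measure.isProbabilityMeasure_map (μ := GamLaw (c0 k) (c1 k)) (hWm k).aemeasurable
  calc _ ≤ levyProkhorovEDist ((GamLaw (c0 k) (c1 k)).map (Y k)) ((GamLaw (c0 k) (c1 k)).map (W k)) +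
        levyProkhorovEDist ((GamLaw (c0 k) (c1 k)).map (W k)) (gaussianReal 0 s.toNNReal) :=
      levyProkhorovEDist_triangle _ _ _
    _ ≤ ε / 2 + ε / 2 := by
      refine add_le_add (h1.trans ?_) k1
      rw [ENNReal.ofReal_coe_nnreal]
      exact heε.le
    _ = ε := ENNReal.add_halves ε

end Helpers

/-- **Theorem 2, part 2 (fiducial Bernstein–von Mises for the bound).**
Let `N_z ~ Multinomial(n_z, q_z)` independently for `z ∈ {0,1}` with
`n_z / (n₀ + n₁) → λ_z ∈ (0,1)`, and given the counts let the fiducial randomness be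
independent `Dirichlet(1, N_z)`.  Let `G*` be the fiducial optimum and `g` the value
function; suppose that on an open set `U ∋ q = (q₀, q₁)` whose trace on the product of
simplices is contained in the feasibility set `F`, `g` agrees with a function `G`
continuously differentiable on `U`.  Then the conditional law of
`√(n₀ + n₁) (G* - g(N₀/n₀, N₁/n₁))` given the data converges in distribution in
probability (in Lévy–Prokhorov distance) to `N(0, σ²)`, with `σ²` as in the CLT for the
plug-in bound. -/
theorem fiducial_bound_bvm
    (q0 q1 : (Fin 2 × Fin 2) → ℝ)
    (hq0 : q0 ∈ stdSimplex ℝ (Fin 2 × Fin 2)) (hq1 : q1 ∈ stdSimplex ℝ (Fin 2 × Fin 2))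
    (f : (Fin 2 → Fin 2 → Fin 2 → Fin 2 → ℝ) → ℝ) (hf : ContDiff ℝ 1 f)
    (G : ((Fin 2 × Fin 2) → ℝ) × ((Fin 2 × Fin 2) → ℝ) → ℝ)
    (U : Set (((Fin 2 × Fin 2) → ℝ) × ((Fin 2 × Fin 2) → ℝ)))
    (hU : IsOpen U) (hqU : (q0, q1) ∈ U)
    (hUF : U ∩ (stdSimplex ℝ (Fin 2 × Fin 2) ×ˢ stdSimplex ℝ (Fin 2 × Fin 2)) ⊆ Feas)
    (hGg : ∀ qq ∈ U ∩ (stdSimplex ℝ (Fin 2 × Fin 2) ×ˢ stdSimplex ℝ (Fin 2 × Fin 2)),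
      G qq = gval f qq)
    (hG : ContDiffOn ℝ 1 G U)
    (n0 n1 : ℕ → ℕ)
    (hn0 : Tendsto n0 atTop atTop) (hn1 : Tendsto n1 atTop atTop)
    (lam0 lam1 : ℝ) (hlam0 : lam0 ∈ Set.Ioo (0 : ℝ) 1) (hlam1 : lam1 ∈ Set.Ioo (0 : ℝ) 1)
    (hratio0 : Tendsto (fun n : ℕ => (n0 n : ℝ) / ((n0 n : ℝ) + (n1 n : ℝ))) atTop (𝓝 lam0))
    (hratio1 : Tendsto (fun n : ℕ => (n1 n : ℝ) / ((n0 n : ℝ) + (n1 n : ℝ))) atTop (𝓝 lam1))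
    -- the partial derivatives `∂g/∂q_{zay}` at `q`
    (D : Fin 2 → (Fin 2 × Fin 2) → ℝ)
    (hD : ∀ z ay, D z ay = fderiv ℝ G (q0, q1)
      (if z = 0 then ((Pi.single ay 1 : (Fin 2 × Fin 2) → ℝ), 0)
       else (0, (Pi.single ay 1 : (Fin 2 × Fin 2) → ℝ))))
    (σ2 : ℝ)
    (hσ2 : σ2 = ∑ z : Fin 2, (if z = 0 then lam0 else lam1)⁻¹ *
      ((∑ ay : Fin 2 × Fin 2, (D z ay) ^ 2 * (if z = 0 then q0 else q1) ay)
        - (∑ ay : Fin 2 × Fin 2, D z ay * (if z = 0 then q0 else q1) ay) ^ 2)) :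
    ∀ ε : ℝ≥0∞, 0 < ε →
      Tendsto
        (fun n : ℕ =>
          ((multinomial (Fin 2 × Fin 2) (n0 n) q0).prod
            (multinomial (Fin 2 × Fin 2) (n1 n) q1))
            {cc | ε ≤
              levyProkhorovEDist
                (Measure.map
                  (fun vv : (Option (Fin 2 × Fin 2) → ℝ) × (Option (Fin 2 × Fin 2) → ℝ) =>
                    Real.sqrt ((n0 n : ℝ) + (n1 n : ℝ)) *
                      (GstarVal f (fun ay => vv.1 (some ay)) (fun ay => vv.2 (some ay))
                        - gval f (fun ay => (cc.1 ay : ℝ) / (n0 n : ℝ),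
                                  fun ay => (cc.2 ay : ℝ) / (n1 n : ℝ))))
                  ((dirichlet (shapeOf cc.1)).prod (dirichlet (shapeOf cc.2))))
                (gaussianReal 0 σ2.toNNReal)})
        atTop (𝓝 0) := by
  intro ε hε
  have hfc : Continuous f := hf.continuous
  set N : ℕ → ℝ := fun k => (n0 k : ℝ) + (n1 k : ℝ) with hNdef
  have hNtop : Tendsto N atTop atTop :=
    (tendsto_natCast_atTop_atTop.comp hn0).atTop_add_atTop (tendsto_natCast_atTop_atTop.comp hn1)
  have hNn : ∀ k, 0 ≤ N k := fun k => by simp only [hNdef]; positivity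
  have hN0 : Tendsto (fun k => N k / n0 k) atTop (𝓝 lam0⁻¹) :=
    (hratio0.inv₀ hlam0.1.ne').congr fun k => by rw [inv_div]
  have hN1 : Tendsto (fun k => N k / n1 k) atTop (𝓝 lam1⁻¹) :=
    (hratio1.inv₀ hlam1.1.ne').congr fun k => by rw [inv_div]
  have hd0 : ∀ i, D 0 i = fderiv ℝ G (q0, q1) ((Pi.single i 1 : Cat → ℝ), 0) := fun i => by
    rw [hD]; simp
  have hd1 : ∀ i, D 1 i = fderiv ℝ G (q0, q1) (0, (Pi.single i 1 : Cat → ℝ)) := fun i => by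
    rw [hD]; simp
  have hs : σ2 = lam0⁻¹ * ∑ i, q0 i * (D 0 i - ∑ j, D 0 j * q0 j) ^ 2 +
      lam1⁻¹ * ∑ i, q1 i * (D 1 i - ∑ j, D 1 j * q1 j) ^ 2 := by
    rw [hσ2, var_eq hq0, var_eq hq1, Fin.sum_univ_two]
    simp
  have key : ∃ δ > 0, ∃ M : ℕ, ∀ k ≥ M, ∀ c0 c1 : Cat → ℕ,
      (∑ j, c0 j = n0 k ∧ ∀ j, |(c0 j : ℝ) / n0 k - q0 j| < δ) →
      (∑ j, c1 j = n1 k ∧ ∀ j, |(c1 j : ℝ) / n1 k - q1 j| < δ) →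
      levyProkhorovEDist ((GamLaw c0 c1).map
        (Yfun f (N k) (fun i => (c0 i : ℝ) / n0 k, fun i => (c1 i : ℝ) / n1 k)))
        (gaussianReal 0 σ2.toNNReal) < ε := by
    by_contra hcon
    push Not at hcon
    have hj : ∀ j : ℕ, (0 : ℝ) < 1 / ((j : ℝ) + 1) := fun j => by positivity
    choose φ hφ c0 c1 h0 h1 hLP using fun j : ℕ => hcon (1 / ((j : ℝ) + 1)) (hj j) j
    have hφt : Tendsto φ atTop atTop := tendsto_atTop_mono hφ tendsto_id
    have hz : ∀ (u : ℕ → ℝ) (a : ℝ), (∀ j, |u j - a| < 1 / ((j : ℝ) + 1)) → Tendsto u atTop (𝓝 a) := by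
      intro u a hu
      rw [tendsto_iff_norm_sub_tendsto_zero]
      exact squeeze_zero (fun j => norm_nonneg _) (fun j => (hu j).le)
        tendsto_one_div_add_atTop_nhds_zero_nat
    have hlim := seq_claim hfc hU hUF hGg hG q0 q1 hqU hq0 hq1 (n0 ∘ φ) (n1 ∘ φ) (hn0.comp hφt)
      (hn1.comp hφt) (N ∘ φ) lam0⁻¹ lam1⁻¹ (inv_nonneg.mpr hlam0.1.le) (inv_nonneg.mpr hlam1.1.le)
      (hNtop.comp hφt) (hN0.comp hφt) (hN1.comp hφt) (fun k => hNn _) c0 c1 (fun k => (h0 k).1)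
      (fun k => (h1 k).1) (fun i => hz _ _ fun j => (h0 j).2 i) (fun i => hz _ _ fun j => (h1 j).2 i)
      (D 0) (D 1) hd0 hd1 σ2 hs
    obtain ⟨j, hjj⟩ := (hlim.eventually (gt_mem_nhds hε)).exists
    exact absurd hjj (not_lt.mpr (hLP j))
  obtain ⟨δ, hδ, M, hM⟩ := key
  have := fun n => multinomial_prob hq0 n
  have := fun n => multinomial_prob hq1 n
  have hup : Tendsto (fun k => 4 * ENNReal.ofReal (1 / (n0 k * δ ^ 2)) +
      4 * ENNReal.ofReal (1 / (n1 k * δ ^ 2))) atTop (𝓝 0) := by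
    have h : ∀ n : ℕ → ℕ, Tendsto n atTop atTop →
        Tendsto (fun k => 4 * ENNReal.ofReal (1 / (n k * δ ^ 2))) atTop (𝓝 0) := by
      intro n hn
      have h1 : Tendsto (fun k => 1 / ((n k : ℝ) * δ ^ 2)) atTop (𝓝 0) := by
        have := (tendsto_natCast_atTop_atTop (R := ℝ).comp hn).atTop_mul_const (pow_pos hδ 2)
        exact (tendsto_inv_atTop_zero.comp this).congr fun k => by simp
      have h2 := ENNReal.Tendsto.const_mul (a := 4) (ENNReal.tendsto_ofReal h1) (Or.inr (by simp))
      simpa using h2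
    simpa using (h n0 hn0).add (h n1 hn1)
  refine tendsto_of_tendsto_of_tendsto_of_le_of_le' tendsto_const_nhds hup
    (Eventually.of_forall fun _ => bot_le) ?_
  filter_upwards [eventually_ge_atTop M, hn0.eventually_gt_atTop 0, hn1.eventually_gt_atTop 0]
    with k k1 k2 k3
  set B0 : Set (Cat → ℕ) := {c | ¬ (∑ j, c j = n0 k ∧ ∀ j, |(c j : ℝ) / n0 k - q0 j| < δ)} with hB0
  set B1 : Set (Cat → ℕ) := {c | ¬ (∑ j, c j = n1 k ∧ ∀ j, |(c j : ℝ) / n1 k - q1 j| < δ)} with hB1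
  refine (measure_mono (t := B0 ×ˢ Set.univ ∪ Set.univ ×ˢ B1) ?_).trans
    ((measure_union_le _ _).trans ?_)
  · intro cc hcc
    by_contra hcon
    simp only [Set.mem_union, Set.mem_prod, Set.mem_univ, and_true, true_and,
      not_or, hB0, hB1, Set.mem_ofPred_eq, not_not] at hcon
    have h1 := hM k k1 cc.1 cc.2 hcon.1 hcon.2
    rw [← law_eq hfc] at h1
    exact absurd h1 (not_lt.mpr hcc)
  · rw [Measure.prod_prod, Measure.prod_prod, measure_univ, measure_univ, one_mul, mul_one]
    exact add_le_add (multinomial_lln hq0 k2 hδ) (multinomial_lln hq1 k3 hδ)
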